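/- arXiv:2412.20754 — 4 statements merged into one kernel-verified Lean document; each statement's English description precedes it below -/
import Mathlib

section
/- Let ℓ ≥ 1 and let a ∈ ℝ∖{0} satisfy the trace condition 2cosh²(ℓ/2) + (a+a⁻¹)sinh²(ℓ/2) = −2cosh(ℓ/2), and let Γ(ℓ,a) be the corresponding symmetric three-funnel Schottky group. Then for every ε ∈ (0,1) there is a constant C > 0 (depending only on ε) such that for all ℓ ≥ 1 and all such a, the Hausdorff dimension of the limit set satisfies |dimH(L(Γ(ℓ,a))) − (log 4)/ℓ| ≤ C·e^{−(1−ε)ℓ/4}. -/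
noncomputable section

/-- The first generator `S₁` of the symmetric three-funnel Schottky group. -/
def S1mat (ℓ : ℝ) : Matrix (Fin 2) (Fin 2) ℝ :=
  !![Real.cosh (ℓ / 2), Real.sinh (ℓ / 2); Real.sinh (ℓ / 2), Real.cosh (ℓ / 2)]

lemma S1mat_det (ℓ : ℝ) : (S1mat ℓ).det = 1 := by
  simp only [S1mat, Matrix.det_fin_two_of]
  linear_combination Real.cosh_sq_sub_sinh_sq (ℓ / 2)

/-- `S₁` as an element of `SL₂(ℝ)`. -/
def S1 (ℓ : ℝ) : Matrix.SpecialLinearGroup (Fin 2) ℝ := ⟨S1mat ℓ, S1mat_det ℓ⟩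

/-- The second generator `S₂` of the symmetric three-funnel Schottky group. -/
def S2mat (ℓ a : ℝ) : Matrix (Fin 2) (Fin 2) ℝ :=
  !![Real.cosh (ℓ / 2), a⁻¹ * Real.sinh (ℓ / 2); a * Real.sinh (ℓ / 2), Real.cosh (ℓ / 2)]

lemma S2mat_det (ℓ a : ℝ) (ha : ¬ a = 0) : (S2mat ℓ a).det = 1 := by
  have h2 : a⁻¹ * a = 1 := inv_mul_cancel₀ ha
  simp only [S2mat, Matrix.det_fin_two_of]
  linear_combination Real.cosh_sq_sub_sinh_sq (ℓ / 2)
    - Real.sinh (ℓ / 2) * Real.sinh (ℓ / 2) * h2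

/-- `S₂` as an element of `SL₂(ℝ)` (junk value `1` when `a = 0`). -/
def S2 (ℓ a : ℝ) : Matrix.SpecialLinearGroup (Fin 2) ℝ :=
  if h : a = 0 then 1 else ⟨S2mat ℓ a, S2mat_det ℓ a h⟩

/-- The symmetric three-funnel Schottky group `Γ(ℓ,a) = ⟨S₁,S₂⟩ ≤ SL₂(ℝ)`. -/
def threeFunnelGroup (ℓ a : ℝ) : Subgroup (Matrix.SpecialLinearGroup (Fin 2) ℝ) :=
  Subgroup.closure {S1 ℓ, S2 ℓ a}

/-- The Möbius action of `γ = [[p,q],[r,s]]` on the point `i`: `(p·i+q)/(r·i+s)`. -/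
def moebiusAtI (γ : Matrix.SpecialLinearGroup (Fin 2) ℝ) : ℂ :=
  ((γ.1 0 0 : ℂ) * Complex.I + (γ.1 0 1 : ℂ)) /
    ((γ.1 1 0 : ℂ) * Complex.I + (γ.1 1 1 : ℂ))

/-- The limit set of a subgroup `Γ ≤ SL₂(ℝ)`: all `x ∈ ℝ` which are limits of `γₙ · i`
along a sequence of pairwise distinct elements of `Γ`. -/
def limitSet (Γ : Subgroup (Matrix.SpecialLinearGroup (Fin 2) ℝ)) : Set ℝ :=
  {x : ℝ | ∃ γ : ℕ → Matrix.SpecialLinearGroup (Fin 2) ℝ,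
    (∀ n, γ n ∈ Γ) ∧ Function.Injective γ ∧
    Filter.Tendsto (fun n => moebiusAtI (γ n)) Filter.atTop (nhds (x : ℂ))}

/-! ### Letters and the four Möbius maps -/

/-- Letters: the first component selects the generator, the second one its orientation. -/
abbrev Ltr := Bool × Bool

/-- The three admissible successors of a letter. -/
def nxt (p : Ltr) (d : Fin 3) : Ltr :=
  if d = 0 then p else if d = 1 then (!p.1, p.2) else (!p.1, !p.2)

/-- The weight (number of bits) of a transition. -/
def bits (d : Fin 3) : ℕ := if d = 2 then 1 else 2

/-- The attracting fixed points. -/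
def vv (b : ℝ) (p : Ltr) : ℝ := (if p.2 then 1 else -1) * (if p.1 then b else 1)

/-- Denominators. -/
def mm (ℓ b : ℝ) (p : Ltr) (z : ℂ) : ℂ :=
  ((Real.sinh (ℓ / 2) / vv b p : ℝ) : ℂ) * z + (Real.cosh (ℓ / 2) : ℝ)

/-- The Möbius maps. -/
def ff (ℓ b : ℝ) (p : Ltr) (z : ℂ) : ℂ :=
  (((Real.cosh (ℓ / 2) : ℝ) : ℂ) * z + (vv b p * Real.sinh (ℓ / 2) : ℝ)) / mm ℓ b p z

/-- The generators by letters. -/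
def gg (ℓ a : ℝ) (p : Ltr) : Matrix.SpecialLinearGroup (Fin 2) ℝ :=
  match p with
  | (false, true) => S1 ℓ
  | (false, false) => (S1 ℓ)⁻¹
  | (true, true) => (S2 ℓ a)⁻¹
  | (true, false) => S2 ℓ a

/-- The inverse letter. -/
def linv (p : Ltr) : Ltr := (p.1, !p.2)

lemma gg_linv (ℓ a : ℝ) (p : Ltr) : gg ℓ a (linv p) = (gg ℓ a p)⁻¹ := by
  rcases p with ⟨_ | _, _ | _⟩ <;> simp [gg, linv]

lemma eq_linv_or_nxt (p q : Ltr) : p = linv q ∨ ∃ d, p = nxt q d := by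
  revert p q; decide

lemma nxt_inj (p : Ltr) : ∀ d d' : Fin 3, nxt p d = nxt p d' → d = d' := by
  revert p; decide

lemma one_le_bits (d : Fin 3) : 1 ≤ bits d := by revert d; decide

lemma gg_mem (ℓ a : ℝ) (p : Ltr) : gg ℓ a p ∈ threeFunnelGroup ℓ a := by
  have h1 : S1 ℓ ∈ threeFunnelGroup ℓ a := Subgroup.subset_closure (by simp)
  have h2 : S2 ℓ a ∈ threeFunnelGroup ℓ a := Subgroup.subset_closure (by simp)
  rcases p with ⟨_ | _, _ | _⟩
  · exact inv_mem h1
  · exact h1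
  · exact h2
  · exact inv_mem h2

lemma gg_entries (ℓ a b : ℝ) (ha : a ≠ 0) (hb : a * b = -1) (p : Ltr) :
    (gg ℓ a p).1 = !![Real.cosh (ℓ / 2), vv b p * Real.sinh (ℓ / 2);
      Real.sinh (ℓ / 2) / vv b p, Real.cosh (ℓ / 2)] := by
  have hb0 : b ≠ 0 := by rintro rfl; simp at hb
  have e1 : a = -b⁻¹ := by field_simp; linarith
  have e2 : a⁻¹ = -b := by rw [e1]; simp
  have e3 : (S2 ℓ a).1 = S2mat ℓ a := by simp [S2, ha]
  rcases p with ⟨_ | _, _ | _⟩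
  · show ((S1 ℓ)⁻¹).1 = _
    have e4 : (S1 ℓ).1 = S1mat ℓ := rfl
    rw [Matrix.SpecialLinearGroup.coe_inv, e4, S1mat, Matrix.adjugate_fin_two_of]
    simp [vv, div_neg]
  · show (S1 ℓ).1 = _
    simp [S1, S1mat, vv]
  · show (S2 ℓ a).1 = _
    rw [e3, S2mat, e2, e1]; simp [vv]; field_simp
  · show ((S2 ℓ a)⁻¹).1 = _
    rw [Matrix.SpecialLinearGroup.coe_inv, e3, S2mat, Matrix.adjugate_fin_two_of, e2, e1]
    simp [vv]; field_simp

lemma moeb_den_ne (γ : Matrix.SpecialLinearGroup (Fin 2) ℝ) :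
    ((γ.1 1 0 : ℂ) * Complex.I + (γ.1 1 1 : ℂ)) ≠ 0 := by
  intro h
  have h1 := congrArg Complex.re h
  have h2 := congrArg Complex.im h
  simp at h1 h2
  have := γ.2
  rw [Matrix.det_fin_two, h1, h2] at this
  simp at this

lemma moeb_mul (ℓ a b : ℝ) (ha : a ≠ 0) (hb : a * b = -1) (p : Ltr)
    (γ : Matrix.SpecialLinearGroup (Fin 2) ℝ) :
    moebiusAtI (gg ℓ a p * γ) = ff ℓ b p (moebiusAtI γ) := by
  have hd := moeb_den_ne γ
  have hE : (gg ℓ a p * γ).1 = (gg ℓ a p).1 * γ.1 := rfl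
  have hz : moebiusAtI γ * ((γ.1 1 0 : ℂ) * Complex.I + (γ.1 1 1 : ℂ)) =
      (γ.1 0 0 : ℂ) * Complex.I + (γ.1 0 1 : ℂ) := div_mul_cancel₀ _ hd
  unfold ff mm
  refine Eq.trans ?_ (mul_div_mul_right _ _ hd)
  generalize moebiusAtI γ = z at hz
  unfold moebiusAtI
  rw [hE, gg_entries ℓ a b ha hb p]
  simp only [Matrix.mul_apply, Fin.sum_univ_two]
  simp only [Matrix.of_apply, Matrix.cons_val', Matrix.cons_val_zero, Matrix.cons_val_one,
    Matrix.cons_val_fin_one]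
  congr 1
  · push_cast
    linear_combination (-Complex.cosh (ℓ / 2)) * hz
  · push_cast
    linear_combination (-(Complex.sinh (ℓ / 2) / vv b p)) * hz

lemma moeb_one : moebiusAtI 1 = Complex.I := by simp [moebiusAtI]

lemma moeb_gg (ℓ a b : ℝ) (ha : a ≠ 0) (hb : a * b = -1) (p : Ltr) :
    moebiusAtI (gg ℓ a p) = ff ℓ b p Complex.I := by
  rw [← mul_one (gg ℓ a p), moeb_mul ℓ a b ha hb, moeb_one]

lemma ff_conj (ℓ b : ℝ) (p : Ltr) (z : ℂ) :
    ff ℓ b p (starRingEnd ℂ z) = starRingEnd ℂ (ff ℓ b p z) := by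
  simp only [ff, mm, map_div₀, map_add, map_mul, Complex.conj_ofReal]

lemma vv_ne (b : ℝ) (hb : b ≠ 0) (p : Ltr) : vv b p ≠ 0 := by
  rcases p with ⟨_ | _, _ | _⟩ <;> simp [vv, hb]

lemma ff_sub (ℓ b : ℝ) (hb : b ≠ 0) (p : Ltr) (z w : ℂ) (hz : mm ℓ b p z ≠ 0)
    (hw : mm ℓ b p w ≠ 0) :
    ff ℓ b p z - ff ℓ b p w = (z - w) / (mm ℓ b p z * mm ℓ b p w) := by
  have hv : ((vv b p : ℝ) : ℂ) ≠ 0 := by exact_mod_cast vv_ne b hb p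
  have hcs : ((Real.cosh (ℓ / 2) : ℝ) : ℂ) ^ 2 - ((Real.sinh (ℓ / 2) : ℝ) : ℂ) ^ 2 = 1 := by
    exact_mod_cast Real.cosh_sq_sub_sinh_sq (ℓ / 2)
  unfold ff
  rw [div_sub_div _ _ hz hw]
  congr 1
  unfold mm
  rw [Complex.ofReal_div, Complex.ofReal_mul]
  field_simp
  linear_combination (z - w) * (vv b p : ℂ) * hcs

lemma ff_sub_vv (ℓ b : ℝ) (hb : b ≠ 0) (p : Ltr) (z : ℂ) (hz : mm ℓ b p z ≠ 0) :
    ff ℓ b p z - vv b p =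
      ((Real.cosh (ℓ / 2) - Real.sinh (ℓ / 2) : ℝ) : ℂ) * (z - vv b p) / mm ℓ b p z := by
  have hv : ((vv b p : ℝ) : ℂ) ≠ 0 := by exact_mod_cast vv_ne b hb p
  unfold ff
  rw [div_sub' hz]
  congr 1
  unfold mm
  rw [Complex.ofReal_div, Complex.ofReal_mul, Complex.ofReal_sub]
  field_simp
  ring

/-- The quantitative facts about the iterated function system. -/
structure Good (ℓ b r m1 m2 σ : ℝ) : Prop where
  b_ne : b ≠ 0
  r_pos : 0 < r
  r_le : 2 * r ≤ 1
  one_lt : 1 < m1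
  m_le : m1 ≤ m2
  σ_pos : 0 < σ
  hB : ∀ p d z, dist z (vv b (nxt p d) : ℂ) ≤ r → dist (ff ℓ b p z) (vv b p : ℂ) ≤ r
  hI : ∀ p, dist (ff ℓ b p Complex.I) (vv b p : ℂ) ≤ r
  hlow : ∀ p d z, dist z (vv b (nxt p d) : ℂ) ≤ r → m1 ^ bits d ≤ ‖mm ℓ b p z‖
  hup : ∀ p d z, dist z (vv b (nxt p d) : ℂ) ≤ r → ‖mm ℓ b p z‖ ≤ m2 ^ bits d
  hsep : ∀ p d d' z w, d ≠ d' → dist z (vv b (nxt p d) : ℂ) ≤ r →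
    dist w (vv b (nxt p d') : ℂ) ≤ r → σ ≤ dist z w

lemma not_I {ℓ b r m1 m2 σ : ℝ} (h : Good ℓ b r m1 m2 σ) (p : Ltr) :
    ¬ dist Complex.I (vv b p : ℂ) ≤ r := by
  intro hh
  have h1 := Complex.abs_im_le_norm (Complex.I - vv b p)
  rw [dist_eq_norm] at hh
  simp at h1
  have := h.r_le
  linarith

lemma Good.mm_ne {ℓ b r m1 m2 σ : ℝ} (h : Good ℓ b r m1 m2 σ) {p : Ltr} {d : Fin 3} {z : ℂ}
    (hz : dist z (vv b (nxt p d) : ℂ) ≤ r) : mm ℓ b p z ≠ 0 := by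
  have h1 := h.hlow p d z hz
  have h2 : 0 < m1 ^ bits d := pow_pos (by linarith [h.one_lt]) _
  exact norm_pos_iff.1 (by linarith)

lemma Good.dist_ff {ℓ b r m1 m2 σ : ℝ} (h : Good ℓ b r m1 m2 σ) {p : Ltr} {d d' : Fin 3} {z w : ℂ}
    (hz : dist z (vv b (nxt p d) : ℂ) ≤ r) (hw : dist w (vv b (nxt p d') : ℂ) ≤ r) :
    dist (ff ℓ b p z) (ff ℓ b p w) = dist z w / (‖mm ℓ b p z‖ * ‖mm ℓ b p w‖) := by
  rw [dist_eq_norm, ff_sub ℓ b h.b_ne p z w (h.mm_ne hz) (h.mm_ne hw), norm_div, norm_mul,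
    dist_eq_norm]

lemma Good.dist_le {ℓ b r m1 m2 σ : ℝ} (h : Good ℓ b r m1 m2 σ) {p : Ltr} {d : Fin 3} {z w : ℂ}
    (hz : dist z (vv b (nxt p d) : ℂ) ≤ r) (hw : dist w (vv b (nxt p d) : ℂ) ≤ r) :
    dist (ff ℓ b p z) (ff ℓ b p w) ≤ dist z w * ((m1 ^ 2)⁻¹) ^ bits d := by
  rw [h.dist_ff hz hw, div_eq_mul_inv]
  have h0 : 0 < m1 := by linarith [h.one_lt]
  have h2 : 0 < m1 ^ bits d := pow_pos h0 _
  have e : ((m1 ^ 2)⁻¹) ^ bits d = (m1 ^ bits d * m1 ^ bits d)⁻¹ := by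
    rw [inv_pow, ← pow_mul, ← pow_add]; congr 2; ring
  rw [e]
  have := h.hlow p d z hz
  have := h.hlow p d w hw
  gcongr

lemma Good.le_dist {ℓ b r m1 m2 σ : ℝ} (h : Good ℓ b r m1 m2 σ) {p : Ltr} {d : Fin 3} {z w : ℂ}
    (hz : dist z (vv b (nxt p d) : ℂ) ≤ r) (hw : dist w (vv b (nxt p d) : ℂ) ≤ r) :
    dist z w * ((m2 ^ 2)⁻¹) ^ bits d ≤ dist (ff ℓ b p z) (ff ℓ b p w) := by
  rw [h.dist_ff hz hw, div_eq_mul_inv]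
  have e : ((m2 ^ 2)⁻¹) ^ bits d = (m2 ^ bits d * m2 ^ bits d)⁻¹ := by
    rw [inv_pow, ← pow_mul, ← pow_add]; congr 2; ring
  rw [e]
  have h1 := h.hup p d z hz
  have h2 := h.hup p d w hw
  have h3 := norm_pos_iff.2 (h.mm_ne hz)
  have h4 := norm_pos_iff.2 (h.mm_ne hw)
  have h5 := h3.le.trans h1
  gcongr

lemma Good.sep {ℓ b r m1 m2 σ : ℝ} (h : Good ℓ b r m1 m2 σ) {p : Ltr} {d d' : Fin 3} {z w : ℂ}
    (hd : d ≠ d')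
    (hz : dist z (vv b (nxt p d) : ℂ) ≤ r) (hw : dist w (vv b (nxt p d') : ℂ) ≤ r) :
    σ * (m2 ^ 4)⁻¹ ≤ dist (ff ℓ b p z) (ff ℓ b p w) := by
  rw [h.dist_ff hz hw, div_eq_mul_inv]
  have h1 := h.hup p d z hz
  have h2 := h.hup p d' w hw
  have h3 := norm_pos_iff.2 (h.mm_ne hz)
  have h4 := norm_pos_iff.2 (h.mm_ne hw)
  have h5 := h.hsep p d d' z w hd hz hw
  have hm : 1 ≤ m2 := by linarith [h.one_lt, h.m_le]
  have hb : ∀ d, m2 ^ bits d ≤ m2 ^ 2 := fun d => pow_le_pow_right₀ hm (by revert d; decide)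
  have e : m2 ^ 4 = m2 ^ 2 * m2 ^ 2 := by ring
  rw [e]
  have h6 := h1.trans (hb d)
  have h7 := h2.trans (hb d')
  have := h.σ_pos
  gcongr

/-! ### Upper bound -/

/-- Cylinder sets. -/
def GG (ℓ b r : ℝ) : (n : ℕ) → Ltr → (Fin n → Fin 3) → Set ℂ
  | 0, p, _ => Metric.closedBall (vv b p : ℂ) r
  | n + 1, p, ds => ff ℓ b p '' GG ℓ b r n (nxt p (ds 0)) (Fin.tail ds)

lemma GG_sub {ℓ b r m1 m2 σ : ℝ} (h : Good ℓ b r m1 m2 σ) (n : ℕ) :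
    ∀ (p : Ltr) (ds : Fin n → Fin 3), ∀ z ∈ GG ℓ b r n p ds, dist z (vv b p : ℂ) ≤ r := by
  induction n with
  | zero => intro p ds z hz; exact hz
  | succ n ih =>
    rintro p ds z ⟨w, hw, rfl⟩
    exact h.hB p (ds 0) w (ih _ _ w hw)

lemma GG_dist {ℓ b r m1 m2 σ : ℝ} (h : Good ℓ b r m1 m2 σ) (n : ℕ) :
    ∀ (p : Ltr) (ds : Fin n → Fin 3), ∀ z ∈ GG ℓ b r n p ds, ∀ w ∈ GG ℓ b r n p ds,
      dist z w ≤ 2 * r * ∏ i, ((m1 ^ 2)⁻¹) ^ bits (ds i) := by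
  induction n with
  | zero =>
    intro p ds z hz w hw
    have h1 : dist z (vv b p : ℂ) ≤ r := hz
    have h2 : dist w (vv b p : ℂ) ≤ r := hw
    have := dist_triangle_right z w (vv b p : ℂ)
    simp; linarith
  | succ n ih =>
    rintro p ds _ ⟨z, hz, rfl⟩ _ ⟨w, hw, rfl⟩
    have h1 := h.dist_le (GG_sub h n _ _ z hz) (GG_sub h n _ _ w hw)
    have h2 := ih _ _ z hz w hw
    rw [Fin.prod_univ_succ]
    have h3 : 0 ≤ ((m1 ^ 2)⁻¹) ^ bits (ds 0) := by positivity
    calc _ ≤ _ := h1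
      _ ≤ (2 * r * ∏ i, ((m1 ^ 2)⁻¹) ^ bits (Fin.tail ds i)) * ((m1 ^ 2)⁻¹) ^ bits (ds 0) := by
        gcongr
      _ = _ := by simp only [Fin.tail]; ring

/-- Reduced words with first letter `p` and `n + 1` letters. -/
inductive Red (ℓ a : ℝ) : Ltr → ℕ → Matrix.SpecialLinearGroup (Fin 2) ℝ → Prop
  | single (p : Ltr) : Red ℓ a p 0 (gg ℓ a p)
  | cons (p : Ltr) (d : Fin 3) (n : ℕ) (γ : Matrix.SpecialLinearGroup (Fin 2) ℝ) :
      Red ℓ a (nxt p d) n γ → Red ℓ a p (n + 1) (gg ℓ a p * γ)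

lemma red_mul (ℓ a : ℝ) (q : Ltr) (γ : Matrix.SpecialLinearGroup (Fin 2) ℝ)
    (h : γ = 1 ∨ ∃ p n, Red ℓ a p n γ) :
    gg ℓ a q * γ = 1 ∨ ∃ p n, Red ℓ a p n (gg ℓ a q * γ) := by
  rcases h with rfl | ⟨p, n, h⟩
  · right; refine ⟨q, 0, ?_⟩; rw [mul_one]; exact Red.single q
  · rcases eq_linv_or_nxt p q with hp | ⟨d, rfl⟩
    · cases h with
      | single => left; rw [hp, gg_linv]; simp
      | cons _ d n γ' h' =>
        right; refine ⟨nxt p d, n, ?_⟩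
        have e : gg ℓ a q * (gg ℓ a p * γ') = γ' := by rw [hp, gg_linv, mul_inv_cancel_left]
        rw [e]; exact h'
    · right; exact ⟨q, _, Red.cons q d n γ h⟩

lemma red_of_mem (ℓ a : ℝ) {γ : Matrix.SpecialLinearGroup (Fin 2) ℝ}
    (h : γ ∈ threeFunnelGroup ℓ a) : γ = 1 ∨ ∃ p n, Red ℓ a p n γ := by
  unfold threeFunnelGroup at h
  induction h using Subgroup.closure_induction_left with
  | one => left; rfl
  | mul_left x hx y hy ih =>
    rcases hx with rfl | rfl
    · exact red_mul ℓ a (false, true) y ih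
    · exact red_mul ℓ a (true, false) y ih
  | inv_mul_cancel x hx y hy ih =>
    rcases hx with rfl | rfl
    · exact red_mul ℓ a (false, false) y ih
    · exact red_mul ℓ a (true, true) y ih

lemma red_finite (ℓ a : ℝ) (n : ℕ) : {γ | ∃ p, Red ℓ a p n γ}.Finite := by
  induction n with
  | zero =>
    refine (Set.finite_range (gg ℓ a)).subset ?_
    rintro γ ⟨p, h⟩
    cases h
    exact ⟨p, rfl⟩
  | succ n ih =>
    refine (Set.Finite.image2 (fun x y => x * y) (Set.finite_range (gg ℓ a)) ih).subset ?_
    rintro γ ⟨p, h⟩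
    cases h with
    | cons _ d _ γ' h' => exact ⟨gg ℓ a p, ⟨p, rfl⟩, γ', ⟨_, h'⟩, rfl⟩

lemma red_ball {ℓ a b r m1 m2 σ : ℝ} (h : Good ℓ b r m1 m2 σ) (ha : a ≠ 0) (hb : a * b = -1)
    {p : Ltr} {n : ℕ} {γ : Matrix.SpecialLinearGroup (Fin 2) ℝ} (hγ : Red ℓ a p n γ) :
    dist (moebiusAtI γ) (vv b p : ℂ) ≤ r := by
  induction hγ with
  | single p => rw [moeb_gg ℓ a b ha hb]; exact h.hI p
  | cons p d n γ _ ih => rw [moeb_mul ℓ a b ha hb]; exact h.hB p d _ ih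

lemma red_cyl {ℓ a b r m1 m2 σ : ℝ} (h : Good ℓ b r m1 m2 σ) (ha : a ≠ 0) (hb : a * b = -1)
    (n : ℕ) : ∀ (p : Ltr) (k : ℕ) (γ : Matrix.SpecialLinearGroup (Fin 2) ℝ), n ≤ k →
      Red ℓ a p k γ → ∃ ds : Fin n → Fin 3, moebiusAtI γ ∈ GG ℓ b r n p ds := by
  induction n with
  | zero => intro p k γ _ hγ; exact ⟨Fin.elim0, red_ball h ha hb hγ⟩
  | succ n ih =>
    intro p k γ hk hγ
    cases hγ with
    | single => omega
    | cons _ d k γ' h' =>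
      obtain ⟨ds, hds⟩ := ih _ k γ' (by omega) h'
      refine ⟨Fin.cons d ds, ?_⟩
      rw [moeb_mul ℓ a b ha hb]
      refine ⟨_, ?_, rfl⟩
      simpa using hds

lemma limit_cover {ℓ a b r m1 m2 σ : ℝ} (h : Good ℓ b r m1 m2 σ) (ha : a ≠ 0) (hb : a * b = -1)
    (n : ℕ) : Complex.ofReal '' limitSet (threeFunnelGroup ℓ a) ⊆
      ⋃ i : Ltr × (Fin n → Fin 3), closure (GG ℓ b r n i.1 i.2) := by
  rintro _ ⟨x, ⟨γ, hγ, hinj, hlim⟩, rfl⟩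
  have hcl : IsClosed (⋃ i : Ltr × (Fin n → Fin 3), closure (GG ℓ b r n i.1 i.2)) :=
    isClosed_iUnion_of_finite fun _ => isClosed_closure
  refine hcl.mem_of_tendsto hlim ?_
  have hfin : (insert 1 (⋃ k ∈ Set.Iio n, {γ | ∃ p, Red ℓ a p k γ})).Finite :=
    ((Set.finite_Iio n).biUnion fun k _ => red_finite ℓ a k).insert 1
  have h1 := hinj.tendsto_cofinite.eventually hfin.compl_mem_cofinite
  rw [Nat.cofinite_eq_atTop] at h1
  filter_upwards [h1] with k hk
  rcases red_of_mem ℓ a (hγ k) with h1 | ⟨p, m, hm⟩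
  · exact absurd (Set.mem_insert_iff.2 (Or.inl h1)) hk
  · have hnm : n ≤ m := by
      by_contra hlt
      refine hk (Set.mem_insert_iff.2 (Or.inr ?_))
      exact Set.mem_biUnion (Set.mem_Iio.2 (not_le.1 hlt)) ⟨p, hm⟩
    obtain ⟨ds, hds⟩ := red_cyl h ha hb n p m _ hnm hm
    exact Set.mem_iUnion.2 ⟨(p, ds), subset_closure hds⟩

lemma sum_half (n : ℕ) :
    ∑ ds : Fin n → Fin 3, ∏ i, ((1 / 2 : ℝ)) ^ bits (ds i) = 1 := by
  have := Finset.prod_univ_sum (fun _ : Fin n => (Finset.univ : Finset (Fin 3)))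
    (fun _ d => (1 / 2 : ℝ) ^ bits d)
  rw [Fintype.piFinset_univ] at this
  rw [← this]
  have e : ∑ d : Fin 3, (1 / 2 : ℝ) ^ bits d = 1 := by
    simp [Fin.sum_univ_three, bits]; norm_num
  simp only [e]; simp

open MeasureTheory in
lemma upper_bound {ℓ a b r m1 m2 σ : ℝ} (h : Good ℓ b r m1 m2 σ) (ha : a ≠ 0) (hb : a * b = -1)
    (d : NNReal) (hd : (m1 ^ 2)⁻¹ ^ (d : ℝ) = 1 / 2) :
    dimH (limitSet (threeFunnelGroup ℓ a)) ≤ d := by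
  rw [← (Complex.isometry_ofReal).dimH_image]
  set θ := (m1 ^ 2)⁻¹ with hθ
  have hm := h.one_lt
  have hθ0 : 0 < θ := by positivity
  have hθ1 : θ < 1 := inv_lt_one_of_one_lt₀ (by nlinarith)
  have hr0 := h.r_pos
  have hdiam : ∀ (n : ℕ) (i : Ltr × (Fin n → Fin 3)),
      Metric.ediam (closure (GG ℓ b r n i.1 i.2)) ≤
        ENNReal.ofReal (2 * r * ∏ j, θ ^ bits (i.2 j)) := by
    intro n i
    rw [Metric.ediam_closure]
    refine Metric.ediam_le fun x hx y hy => ?_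
    rw [edist_dist]
    exact ENNReal.ofReal_le_ofReal (GG_dist h n _ _ x hx y hy)
  refine dimH_le_of_hausdorffMeasure_ne_top ?_
  have key := Measure.hausdorffMeasure_le_liminf_sum (d : ℝ)
    (Complex.ofReal '' limitSet (threeFunnelGroup ℓ a)) (l := Filter.atTop)
    (fun n : ℕ => ENNReal.ofReal (2 * r * θ ^ n)) ?_
    (fun n (i : Ltr × (Fin n → Fin 3)) => closure (GG ℓ b r n i.1 i.2)) ?_ ?_
  · refine ne_top_of_le_ne_top (b := ENNReal.ofReal 4) ENNReal.ofReal_ne_top (key.trans ?_)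
    refine Filter.liminf_le_of_frequently_le' (Filter.Frequently.of_forall fun n => ?_)
    have h1 : ∀ i : Ltr × (Fin n → Fin 3),
        Metric.ediam (closure (GG ℓ b r n i.1 i.2)) ^ (d : ℝ) ≤
          ENNReal.ofReal (∏ j, (1 / 2 : ℝ) ^ bits (i.2 j)) := by
      intro i
      have hp : 0 ≤ ∏ j, θ ^ bits (i.2 j) := Finset.prod_nonneg fun j _ => by positivity
      refine (ENNReal.rpow_le_rpow (hdiam n i) d.2).trans ?_
      rw [ENNReal.ofReal_rpow_of_nonneg (by positivity) d.2]
      refine ENNReal.ofReal_le_ofReal ?_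
      have h2 : 2 * r * ∏ j, θ ^ bits (i.2 j) ≤ ∏ j, θ ^ bits (i.2 j) := by
        nlinarith [h.r_le]
      refine (Real.rpow_le_rpow (by positivity) h2 d.2).trans ?_
      rw [← Real.finsetProd_rpow _ _ (fun j _ => by positivity)]
      refine le_of_eq (Finset.prod_congr rfl fun j _ => ?_)
      rw [← hd, ← Real.rpow_natCast, ← Real.rpow_natCast, ← Real.rpow_mul hθ0.le,
        ← Real.rpow_mul hθ0.le, mul_comm]
      rfl
    refine (Finset.sum_le_sum fun i _ => h1 i).trans ?_
    rw [← ENNReal.ofReal_sum_of_nonneg (fun i _ => Finset.prod_nonneg fun j _ => by positivity)]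
    refine ENNReal.ofReal_le_ofReal (le_of_eq ?_)
    rw [Fintype.sum_prod_type]
    simp only [sum_half]
    simp
  · have : Filter.Tendsto (fun n : ℕ => 2 * r * θ ^ n) Filter.atTop (nhds 0) := by
      simpa using (tendsto_pow_atTop_nhds_zero_of_lt_one hθ0.le hθ1).const_mul (2 * r)
    simpa using ENNReal.tendsto_ofReal this
  · refine Filter.Eventually.of_forall fun n i => (hdiam n i).trans ?_
    refine ENNReal.ofReal_le_ofReal ?_
    have : ∏ j, θ ^ bits (i.2 j) ≤ ∏ j : Fin n, θ :=
      Finset.prod_le_prod (fun j _ => by positivity)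
        (fun j _ => pow_le_of_le_one hθ0.le hθ1.le (by have := one_le_bits (i.2 j); omega))
    simp at this
    gcongr
  · exact Filter.Eventually.of_forall fun n => limit_cover h ha hb n

/-! ### Lower bound -/

/-- First digit. -/
def dig (x : ℝ) : Fin 3 := if x < 1 / 4 then 0 else if x < 1 / 2 then 1 else 2

/-- The expanding interval map with inverse branches of slopes `1/4, 1/4, 1/2`. -/
def TT (x : ℝ) : ℝ := if x < 1 / 4 then 4 * x else if x < 1 / 2 then 4 * x - 1 else 2 * x - 1

lemma TT_mem {x : ℝ} (hx : x ∈ Set.Ico (0 : ℝ) 1) : TT x ∈ Set.Ico (0 : ℝ) 1 := by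
  obtain ⟨h0, h1⟩ := hx
  unfold TT
  split_ifs <;> constructor <;> linarith

lemma TT_dist {x y : ℝ} (h : dig x = dig y) :
    |x - y| = (1 / 2 : ℝ) ^ bits (dig x) * |TT x - TT y| := by
  have key : ∀ k t : ℝ, 0 < k → t = k⁻¹ * (x - y) → |x - y| = k * |t| := by
    intro k t hk ht
    rw [ht, abs_mul, abs_of_pos (inv_pos.2 hk)]; field_simp
  unfold dig at h
  unfold dig TT
  split_ifs at h ⊢ <;> simp at h <;> refine key _ _ (by positivity) ?_ <;>
    simp [bits, show ¬ (0 : Fin 3) = 2 by decide, show ¬ (1 : Fin 3) = 2 by decide] <;> ring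

/-- The group elements approximating a limit point. -/
def gm (ℓ a : ℝ) : ℕ → Ltr → ℝ → Matrix.SpecialLinearGroup (Fin 2) ℝ
  | 0, p, _ => gg ℓ a p
  | n + 1, p, x => gg ℓ a p * gm ℓ a n (nxt p (dig x)) (TT x)

lemma gm_mem (ℓ a : ℝ) (n : ℕ) : ∀ p x, gm ℓ a n p x ∈ threeFunnelGroup ℓ a := by
  induction n with
  | zero => intro p x; exact gg_mem ℓ a p
  | succ n ih => intro p x; exact mul_mem (gg_mem ℓ a p) (ih _ _)

lemma gm_ball {ℓ a b r m1 m2 σ : ℝ} (h : Good ℓ b r m1 m2 σ) (ha : a ≠ 0) (hb : a * b = -1)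
    (n : ℕ) : ∀ p x, dist (moebiusAtI (gm ℓ a n p x)) (vv b p : ℂ) ≤ r := by
  induction n with
  | zero => intro p x; rw [gm, moeb_gg ℓ a b ha hb]; exact h.hI p
  | succ n ih => intro p x; rw [gm, moeb_mul ℓ a b ha hb]; exact h.hB p (dig x) _ (ih _ _)

lemma gm_ne {ℓ a b r m1 m2 σ : ℝ} (h : Good ℓ b r m1 m2 σ) (ha : a ≠ 0) (hb : a * b = -1)
    (n k : ℕ) : ∀ p x, gm ℓ a (n + k + 1) p x ≠ gm ℓ a n p x := by
  induction n with
  | zero =>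
    intro p x he
    rw [gm, gm, mul_eq_left] at he
    have := gm_ball h ha hb (0 + k) (nxt p (dig x)) (TT x)
    rw [he, moeb_one] at this
    exact not_I h _ this
  | succ n ih =>
    intro p x he
    rw [show n + 1 + k + 1 = (n + k + 1) + 1 by ring, gm, gm] at he
    exact ih _ _ (mul_left_cancel he)

lemma gm_inj {ℓ a b r m1 m2 σ : ℝ} (h : Good ℓ b r m1 m2 σ) (ha : a ≠ 0) (hb : a * b = -1)
    (p : Ltr) (x : ℝ) : Function.Injective (fun n => gm ℓ a n p x) := by
  have key : ∀ n m : ℕ, n < m → gm ℓ a m p x ≠ gm ℓ a n p x := by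
    intro n m hnm
    obtain ⟨k, rfl⟩ := Nat.exists_eq_add_of_lt hnm
    exact gm_ne h ha hb n k p x
  intro n m he
  rcases lt_trichotomy n m with h1 | h1 | h1
  · exact absurd he.symm (key n m h1)
  · exact h1
  · exact absurd he (key m n h1)

lemma Good.dist_le' {ℓ b r m1 m2 σ : ℝ} (h : Good ℓ b r m1 m2 σ) {p : Ltr} {d : Fin 3} {z w : ℂ}
    (hz : dist z (vv b (nxt p d) : ℂ) ≤ r) (hw : dist w (vv b (nxt p d) : ℂ) ≤ r) :
    dist (ff ℓ b p z) (ff ℓ b p w) ≤ dist z w * (m1 ^ 2)⁻¹ := by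
  have h1 := h.one_lt
  refine (h.dist_le hz hw).trans ?_
  refine mul_le_mul_of_nonneg_left ?_ dist_nonneg
  refine pow_le_of_le_one (by positivity) (inv_le_one_of_one_le₀ (by nlinarith)) ?_
  have := one_le_bits d; omega

lemma gm_cauchy {ℓ a b r m1 m2 σ : ℝ} (h : Good ℓ b r m1 m2 σ) (ha : a ≠ 0) (hb : a * b = -1)
    (n : ℕ) : ∀ p x, dist (moebiusAtI (gm ℓ a n p x)) (moebiusAtI (gm ℓ a (n + 1) p x)) ≤
      2 * r * ((m1 ^ 2)⁻¹) ^ n := by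
  induction n with
  | zero =>
    intro p x
    have h1 := gm_ball h ha hb 0 p x
    have h2 := gm_ball h ha hb (0 + 1) p x
    have := dist_triangle_right (moebiusAtI (gm ℓ a 0 p x)) (moebiusAtI (gm ℓ a (0 + 1) p x))
      (vv b p : ℂ)
    rw [pow_zero]; linarith
  | succ n ih =>
    intro p x
    rw [gm, gm, moeb_mul ℓ a b ha hb, moeb_mul ℓ a b ha hb]
    refine (h.dist_le' (gm_ball h ha hb _ _ _) (gm_ball h ha hb _ _ _)).trans ?_
    rw [pow_succ (m1 ^ 2)⁻¹ n, ← mul_assoc]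
    exact mul_le_mul_of_nonneg_right (ih _ _) (by positivity)

lemma dist_conj_vv (b : ℝ) (p : Ltr) (z : ℂ) :
    dist (starRingEnd ℂ z) (vv b p : ℂ) = dist z (vv b p : ℂ) := by
  rw [← Complex.conj_ofReal (vv b p), Complex.dist_conj_conj, Complex.conj_ofReal]

lemma gm_conj {ℓ a b r m1 m2 σ : ℝ} (h : Good ℓ b r m1 m2 σ) (ha : a ≠ 0) (hb : a * b = -1)
    (n : ℕ) : ∀ p x, dist (moebiusAtI (gm ℓ a n p x)) (starRingEnd ℂ (moebiusAtI (gm ℓ a n p x))) ≤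
      2 * r * ((m1 ^ 2)⁻¹) ^ n := by
  induction n with
  | zero =>
    intro p x
    have h1 := gm_ball h ha hb 0 p x
    have h2 := dist_conj_vv b p (moebiusAtI (gm ℓ a 0 p x))
    have := dist_triangle_right (moebiusAtI (gm ℓ a 0 p x))
      (starRingEnd ℂ (moebiusAtI (gm ℓ a 0 p x))) (vv b p : ℂ)
    rw [pow_zero]; linarith
  | succ n ih =>
    intro p x
    rw [gm, moeb_mul ℓ a b ha hb, ← ff_conj]
    refine (h.dist_le' (gm_ball h ha hb _ _ _) ?_).trans ?_
    · rw [dist_conj_vv]; exact gm_ball h ha hb _ _ _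
    · rw [pow_succ (m1 ^ 2)⁻¹ n, ← mul_assoc]
      exact mul_le_mul_of_nonneg_right (ih _ _) (by positivity)

lemma gm_limit {ℓ a b r m1 m2 σ : ℝ} (h : Good ℓ b r m1 m2 σ) (ha : a ≠ 0) (hb : a * b = -1)
    (p : Ltr) (x : ℝ) : ∃ y : ℝ, y ∈ limitSet (threeFunnelGroup ℓ a) ∧
      Filter.Tendsto (fun n => moebiusAtI (gm ℓ a n p x)) Filter.atTop (nhds (y : ℂ)) := by
  have h1 := h.one_lt
  have hθ1 : (m1 ^ 2)⁻¹ < 1 := inv_lt_one_of_one_lt₀ (by nlinarith)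
  have hc : CauchySeq (fun n => moebiusAtI (gm ℓ a n p x)) :=
    cauchySeq_of_le_geometric _ (2 * r) hθ1 fun n => gm_cauchy h ha hb n p x
  obtain ⟨z, hz⟩ := cauchySeq_tendsto_of_complete hc
  have h2 : Filter.Tendsto (fun n : ℕ => 2 * r * ((m1 ^ 2)⁻¹) ^ n) Filter.atTop (nhds 0) := by
    simpa using (tendsto_pow_atTop_nhds_zero_of_lt_one (by positivity) hθ1).const_mul (2 * r)
  have h3 : dist z (starRingEnd ℂ z) ≤ 0 :=
    le_of_tendsto_of_tendsto' (hz.dist ((Complex.continuous_conj.tendsto z).comp hz)) h2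
      fun n => gm_conj h ha hb n p x
  have h4 : z = starRingEnd ℂ z := dist_le_zero.1 h3
  obtain ⟨y, rfl⟩ := Complex.conj_eq_iff_real.1 h4.symm
  exact ⟨y, ⟨fun n => gm ℓ a n p x, fun n => gm_mem ℓ a n p x, gm_inj h ha hb p x, hz⟩, hz⟩

lemma gm_lower {ℓ a b r m1 m2 σ : ℝ} (h : Good ℓ b r m1 m2 σ) (ha : a ≠ 0) (hb : a * b = -1)
    (E : ℝ) (hE0 : 0 ≤ E) (hE : (m2 ^ 2)⁻¹ = (1 / 2) ^ E) (n : ℕ) :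
    ∀ p, ∀ x ∈ Set.Ico (0 : ℝ) 1, ∀ y ∈ Set.Ico (0 : ℝ) 1,
      σ * (m2 ^ 4)⁻¹ * |x - y| ^ E ≤
        dist (moebiusAtI (gm ℓ a n p x)) (moebiusAtI (gm ℓ a n p y)) ∨
      |x - y| ≤ (1 / 2) ^ n := by
  have hxy1 : ∀ x ∈ Set.Ico (0 : ℝ) 1, ∀ y ∈ Set.Ico (0 : ℝ) 1, |x - y| ≤ 1 := by
    rintro x ⟨hx0, hx1⟩ y ⟨hy0, hy1⟩
    rw [abs_le]; constructor <;> linarith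
  have hm2 : 1 < m2 := lt_of_lt_of_le h.one_lt h.m_le
  have hσ := h.σ_pos
  induction n with
  | zero => intro p x hx y hy; right; simpa using hxy1 x hx y hy
  | succ n ih =>
    intro p x hx y hy
    rw [gm, gm, moeb_mul ℓ a b ha hb, moeb_mul ℓ a b ha hb]
    by_cases hd : dig x = dig y
    · have hT := TT_dist hd
      rw [← hd]
      rcases ih (nxt p (dig x)) _ (TT_mem hx) _ (TT_mem hy) with h1 | h1
      · left
        refine le_trans ?_ (h.le_dist (gm_ball h ha hb _ _ _) (gm_ball h ha hb _ _ _))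
        have e : ((m2 ^ 2)⁻¹) ^ bits (dig x) = ((1 / 2 : ℝ) ^ bits (dig x)) ^ E := by
          rw [hE, ← Real.rpow_natCast, ← Real.rpow_natCast, ← Real.rpow_mul (by norm_num),
            ← Real.rpow_mul (by norm_num), mul_comm]
        rw [hT, Real.mul_rpow (by positivity) (abs_nonneg _), e]
        calc _ = (σ * (m2 ^ 4)⁻¹ * |TT x - TT y| ^ E) * ((1 / 2 : ℝ) ^ bits (dig x)) ^ E := by ring
          _ ≤ _ := mul_le_mul_of_nonneg_right h1 (by positivity)
      · right
        rw [hT, pow_succ, mul_comm]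
        have : (1 / 2 : ℝ) ^ bits (dig x) ≤ 1 / 2 :=
          pow_le_of_le_one (by norm_num) (by norm_num) (by have := one_le_bits (dig x); omega)
        gcongr
    · left
      refine le_trans ?_ (h.sep hd (gm_ball h ha hb _ _ _) (gm_ball h ha hb _ _ _))
      have : |x - y| ^ E ≤ 1 := Real.rpow_le_one (abs_nonneg _) (hxy1 x hx y hy) hE0
      have h0 : 0 ≤ σ * (m2 ^ 4)⁻¹ := by positivity
      nlinarith

lemma lower_bound {ℓ a b r m1 m2 σ : ℝ} (h : Good ℓ b r m1 m2 σ) (ha : a ≠ 0) (hb : a * b = -1)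
    (d : NNReal) (hd0 : 0 < d) (hd : (m2 ^ 2)⁻¹ ^ (d : ℝ) = 1 / 2) :
    d ≤ dimH (limitSet (threeFunnelGroup ℓ a)) := by
  have hm2 : 1 < m2 := lt_of_lt_of_le h.one_lt h.m_le
  have hσ := h.σ_pos
  have hdr : (0 : ℝ) < d := by exact_mod_cast hd0
  have hE : (m2 ^ 2)⁻¹ = (1 / 2 : ℝ) ^ ((d : ℝ)⁻¹) := by
    rw [← hd, ← Real.rpow_mul (by positivity), mul_inv_cancel₀ hdr.ne', Real.rpow_one]
  choose F hF1 hF2 using gm_limit h ha hb (false, true)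
  set c := σ * (m2 ^ 4)⁻¹ with hc
  have hc0 : 0 < c := by positivity
  have hlow : ∀ x ∈ Set.Ico (0 : ℝ) 1, ∀ y ∈ Set.Ico (0 : ℝ) 1,
      c * |x - y| ^ ((d : ℝ)⁻¹) ≤ dist (F x) (F y) := by
    intro x hx y hy
    rcases eq_or_ne x y with rfl | hne
    · simp [Real.zero_rpow (inv_pos.2 hdr).ne']
    · have hpos : 0 < |x - y| := abs_pos.2 (sub_ne_zero.2 hne)
      have h1 : Filter.Tendsto (fun n => dist (moebiusAtI (gm ℓ a n (false, true) x))
          (moebiusAtI (gm ℓ a n (false, true) y))) Filter.atTop (nhds (dist (F x) (F y))) := by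
        have := (hF2 x).dist (hF2 y)
        rwa [Complex.isometry_ofReal.dist_eq] at this
      refine ge_of_tendsto h1 ?_
      have h2 : Filter.Tendsto (fun n : ℕ => (1 / 2 : ℝ) ^ n) Filter.atTop (nhds 0) :=
        tendsto_pow_atTop_nhds_zero_of_lt_one (by norm_num) (by norm_num)
      filter_upwards [h2.eventually (gt_mem_nhds hpos)] with n hn
      rcases gm_lower h ha hb _ (inv_pos.2 hdr).le hE n (false, true) x hx y hy with h3 | h3
      · exact h3
      · linarith
  have hlow2 : ∀ x ∈ Set.Ico (0 : ℝ) 1, ∀ y ∈ Set.Ico (0 : ℝ) 1,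
      |x - y| ≤ (c⁻¹) ^ (d : ℝ) * dist (F x) (F y) ^ (d : ℝ) := by
    intro x hx y hy
    have h1 : |x - y| ^ ((d : ℝ)⁻¹) ≤ c⁻¹ * dist (F x) (F y) := by
      rw [inv_mul_eq_div, le_div_iff₀ hc0, mul_comm]; exact hlow x hx y hy
    have h2 := Real.rpow_le_rpow (by positivity) h1 hdr.le
    rwa [← Real.rpow_mul (abs_nonneg _), inv_mul_cancel₀ hdr.ne', Real.rpow_one,
      Real.mul_rpow (by positivity) dist_nonneg] at h2
  have hinj : Set.InjOn F (Set.Ico 0 1) := by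
    intro x hx y hy he
    have := hlow2 x hx y hy
    rw [he, dist_self, Real.zero_rpow hdr.ne', mul_zero] at this
    exact sub_eq_zero.1 (abs_nonpos_iff.1 this)
  let I : ℝ → ℝ := Function.invFunOn F (Set.Ico 0 1)
  have hI : ∀ x ∈ Set.Ico (0 : ℝ) 1, I (F x) = x := fun x hx => hinj.leftInvOn_invFunOn hx
  have hH : HolderOnWith (Real.toNNReal ((c⁻¹) ^ (d : ℝ))) d I (F '' Set.Ico 0 1) := by
    rintro _ ⟨x, hx, rfl⟩ _ ⟨y, hy, rfl⟩
    rw [hI x hx, hI y hy, edist_dist, edist_dist, Real.dist_eq,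
      ENNReal.ofReal_rpow_of_nonneg dist_nonneg hdr.le]
    change _ ≤ ENNReal.ofReal _ * _
    rw [← ENNReal.ofReal_mul (by positivity)]
    exact ENNReal.ofReal_le_ofReal (hlow2 x hx y hy)
  have h1 := hH.dimH_image_le hd0
  have h2 : I '' (F '' Set.Ico 0 1) = Set.Ico 0 1 := by
    rw [Set.image_image]
    ext x; constructor
    · rintro ⟨y, hy, rfl⟩; simpa only [hI y hy] using hy
    · intro hx; exact ⟨x, hx, hI x hx⟩
  have h3 : dimH (Set.Ico (0 : ℝ) 1) = 1 := by
    rw [Real.dimH_of_nonempty_interior (by simp)]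
    simp
  rw [h2, h3] at h1
  have h4 : (d : ENNReal) ≤ dimH (F '' Set.Ico 0 1) := by
    rwa [ENNReal.le_div_iff_mul_le (by simp [hd0.ne']) (by simp), one_mul] at h1
  refine h4.trans (dimH_mono ?_)
  rintro _ ⟨x, _, rfl⟩
  exact hF1 x

/-! ### Estimates for the maps -/

lemma b_bounds {u U b : ℝ} (huU : u * U = 1) (hU : 100 ≤ U) (hb : 0 < b)
    (h : (1 - b) ^ 2 * (U - u) ^ 2 = 4 * b) :
    |1 - b| ≤ 3 * u ∧ 3 / 2 * u ≤ |1 - b| := by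
  have hu : 0 < u := by
    by_contra hh; nlinarith
  have hu1 : u ≤ 1 / 100 := by nlinarith
  have h1 : (1 - b) ^ 2 * (1 - u ^ 2) ^ 2 = 4 * b * u ^ 2 := by
    have : (1 - u ^ 2) ^ 2 = u ^ 2 * (U - u) ^ 2 := by
      rw [← mul_pow]; congr 1; linear_combination -huU
    rw [this]; linear_combination u ^ 2 * h
  have hu2 : u ^ 2 ≤ 1 / 10000 := by nlinarith
  have h2 : 99 / 100 ≤ (1 - u ^ 2) ^ 2 := by nlinarith
  have h2' : (1 - u ^ 2) ^ 2 ≤ 1 := by nlinarith [sq_nonneg u]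
  have h3 : (1 - b) ^ 2 * (99 / 100) ≤ 4 * b * u ^ 2 := by
    rw [← h1]; exact mul_le_mul_of_nonneg_left h2 (sq_nonneg _)
  have hb2 : b ≤ 2 := by
    by_contra hh
    have : 4 * b * u ^ 2 ≤ 4 * b * (1 / 10000) := by gcongr
    nlinarith
  have h4 : (1 - b) ^ 2 ≤ (3 * u) ^ 2 := by
    have : 4 * b * u ^ 2 ≤ 4 * 2 * u ^ 2 := by gcongr
    nlinarith
  have h5 : |1 - b| ≤ 3 * u := abs_le_of_sq_le_sq h4 (by positivity)
  refine ⟨h5, ?_⟩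
  have hb3 : 97 / 100 ≤ b := by have := (abs_le.1 h5).2; linarith
  have h6 : 4 * b * u ^ 2 ≤ (1 - b) ^ 2 := by
    rw [← h1]; nlinarith [sq_nonneg (1 - b)]
  refine (le_abs_self _).trans (sq_le_sq.1 ?_)
  nlinarith [sq_nonneg u]

lemma far_bounds {u U b s v : ℝ} (huU : u * U = 1) (hU : 100 ≤ U) (hb : 0 < b) (hs0 : 0 < s)
    (hs : s = (U ^ 2 - u ^ 2) / 2)
    (h : (1 - b) ^ 2 * (U - u) ^ 2 = 4 * b) (hv : v = b ∨ v = 1) :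
    U - 5 ≤ s * |1 - b| / v ∧ s * |1 - b| / v ≤ U + 5 := by
  have hu : 0 < u := by
    by_contra hh; nlinarith
  have hu1 : u ≤ 1 / 100 := by nlinarith
  have hu2 : u ^ 2 ≤ 1 / 10000 := by nlinarith
  have hu2' : 0 ≤ u ^ 2 := sq_nonneg u
  have hu3 : 0 < u ^ 3 := by positivity
  have hu3' : u ^ 3 ≤ 1 / 10000 := by nlinarith
  obtain ⟨hb1, hb2⟩ := b_bounds huU hU hb h
  have hU2u : U ^ 2 * u = U := by rw [pow_two, mul_assoc, mul_comm U u, huU, mul_one]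
  have hv0 : 0 < v := by rcases hv with rfl | rfl <;> linarith
  have e : (s * |1 - b|) ^ 2 = b * (U + u) ^ 2 := by
    rw [mul_pow, sq_abs, hs]; linear_combination (U + u) ^ 2 / 4 * h
  have hbl' : 1 - 3 * u ≤ b := by have := (abs_le.1 hb1).2; linarith
  have hbu' : b ≤ 1 + 3 * u := by have := (abs_le.1 hb1).1; linarith
  have e2 : (U + u) ^ 2 = U ^ 2 + 2 + u ^ 2 := by linear_combination 2 * huU
  have hA : (U - 5) ^ 2 ≤ (1 - 3 * u) * (U + u) ^ 2 := by
    have : (1 - 3 * u) * (U + u) ^ 2 = U ^ 2 + 2 + u ^ 2 - 3 * U - 6 * u - 3 * u ^ 3 := by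
      rw [e2]; linear_combination (-3) * hU2u
    rw [this]; linarith
  have hA' : (U - 5) ^ 2 * (1 + 3 * u) ≤ (U + u) ^ 2 := by
    have : (U - 5) ^ 2 * (1 + 3 * u) = U ^ 2 - 10 * U + 25 + 3 * U - 30 + 75 * u := by
      linear_combination 3 * hU2u - 30 * huU
    rw [this, e2]; linarith
  have hC : (1 + 3 * u) * (U + u) ^ 2 ≤ (U + 5) ^ 2 := by
    have : (1 + 3 * u) * (U + u) ^ 2 = U ^ 2 + 2 + u ^ 2 + 3 * U + 6 * u + 3 * u ^ 3 := by
      rw [e2]; linear_combination 3 * hU2u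
    rw [this]; linarith
  have hC' : (U + u) ^ 2 ≤ (U + 5) ^ 2 * (1 - 3 * u) := by
    have : (U + 5) ^ 2 * (1 - 3 * u) = U ^ 2 + 10 * U + 25 - 3 * U - 30 - 75 * u := by
      linear_combination (-3) * hU2u - 30 * huU
    rw [this, e2]; linarith
  have hsq : 0 ≤ (U + u) ^ 2 := sq_nonneg _
  have k1 := hA.trans (mul_le_mul_of_nonneg_right hbl' hsq)
  have k2 := (mul_le_mul_of_nonneg_left hbu' (sq_nonneg (U - 5))).trans hA'
  have k3 := (mul_le_mul_of_nonneg_right hbu' hsq).trans hC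
  have k4 := hC'.trans (mul_le_mul_of_nonneg_left hbl' (sq_nonneg (U + 5)))
  rw [le_div_iff₀ hv0, div_le_iff₀ hv0]
  constructor
  · refine (abs_le_of_sq_le_sq' ?_ (by positivity)).2
    rw [e, mul_pow]
    rcases hv with rfl | rfl
    · linarith [mul_le_mul_of_nonneg_left k2 hb.le]
    · linarith
  · refine (abs_le_of_sq_le_sq' ?_ (by positivity)).2
    rw [e, mul_pow]
    rcases hv with rfl | rfl
    · linarith [mul_le_mul_of_nonneg_left k4 hb.le]
    · linarith

lemma good_of {ℓ u U b : ℝ} (huU : u * U = 1) (hU : 100 ≤ U) (hb : 0 < b)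
    (hc : Real.cosh (ℓ / 2) = (U ^ 2 + u ^ 2) / 2) (hs : Real.sinh (ℓ / 2) = (U ^ 2 - u ^ 2) / 2)
    (h : (1 - b) ^ 2 * (U - u) ^ 2 = 4 * b) :
    Good ℓ b (u ^ 2) (U - 6) (U + 6) u := by
  have hu : 0 < u := by
    by_contra hh; nlinarith
  have hu1 : u ≤ 1 / 100 := by nlinarith
  have hu2 : u ^ 2 ≤ 1 / 10000 := by nlinarith
  obtain ⟨hb1, hb2⟩ := b_bounds huU hU hb h
  have hbl : 97 / 100 ≤ b := by have := (abs_le.1 hb1).2; linarith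
  have hbu : b ≤ 103 / 100 := by have := (abs_le.1 hb1).1; linarith
  have hU2u : U ^ 2 * u = U := by rw [pow_two, mul_assoc, mul_comm U u, huU, mul_one]
  have hU2u2 : U ^ 2 * u ^ 2 = 1 := by rw [← mul_pow, mul_comm, huU, one_pow]
  set s := Real.sinh (ℓ / 2) with hsdef
  set c := Real.cosh (ℓ / 2) with hcdef
  have hs0 : 0 < s := by rw [hs]; nlinarith
  have hsU : s ≤ U ^ 2 / 2 := by rw [hs]; nlinarith
  have hvabs : ∀ p, |vv b p| = if p.1 then b else 1 := by
    rintro ⟨_ | _, _ | _⟩ <;> simp [vv, abs_of_pos hb]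
  have hvl : ∀ p, 97 / 100 ≤ |vv b p| := by
    intro p; rw [hvabs]; split_ifs <;> linarith
  have hvu : ∀ p, |vv b p| ≤ 103 / 100 := by
    intro p; rw [hvabs]; split_ifs <;> linarith
  have hvn : ∀ p, vv b p ≠ 0 := vv_ne b hb.ne'
  have hn1 : ∀ p, |vv b (nxt p 1) - vv b p| = |1 - b| := by
    rintro ⟨_ | _, _ | _⟩ <;> rw [abs_eq_abs] <;>
      first
        | (left; simp [vv, nxt, show ¬ (2 : Fin 3) = 0 by decide, show ¬ (2 : Fin 3) = 1 by decide]; done)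
        | (right; simp [vv, nxt, show ¬ (2 : Fin 3) = 0 by decide, show ¬ (2 : Fin 3) = 1 by decide]; done)
        | (left; simp [vv, nxt, show ¬ (2 : Fin 3) = 0 by decide, show ¬ (2 : Fin 3) = 1 by decide]; ring1)
        | (right; simp [vv, nxt, show ¬ (2 : Fin 3) = 0 by decide, show ¬ (2 : Fin 3) = 1 by decide]; ring1)
  have hn2 : ∀ p, |vv b (nxt p 2) + vv b p| = |1 - b| := by
    rintro ⟨_ | _, _ | _⟩ <;> rw [abs_eq_abs] <;>
      first
        | (left; simp [vv, nxt, show ¬ (2 : Fin 3) = 0 by decide, show ¬ (2 : Fin 3) = 1 by decide]; done)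
        | (right; simp [vv, nxt, show ¬ (2 : Fin 3) = 0 by decide, show ¬ (2 : Fin 3) = 1 by decide]; done)
        | (left; simp [vv, nxt, show ¬ (2 : Fin 3) = 0 by decide, show ¬ (2 : Fin 3) = 1 by decide]; ring1)
        | (right; simp [vv, nxt, show ¬ (2 : Fin 3) = 0 by decide, show ¬ (2 : Fin 3) = 1 by decide]; ring1)
  -- near estimate
  have hnear : ∀ p z, dist z (vv b p : ℂ) ≤ 4 * u → |‖mm ℓ b p z‖ - U ^ 2| ≤ 3 * U := by
    intro p z hz
    have hvc : ((vv b p : ℝ) : ℂ) ≠ 0 := by exact_mod_cast hvn p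
    have e : mm ℓ b p z - ((U ^ 2 : ℝ) : ℂ) = ((s / vv b p : ℝ) : ℂ) * (z - vv b p) := by
      have : ((U ^ 2 : ℝ) : ℂ) = ((c : ℝ) : ℂ) + ((s : ℝ) : ℂ) := by
        rw [← Complex.ofReal_add, hc, hs]; congr 1; ring
      unfold mm
      rw [this, ← hsdef, ← hcdef, Complex.ofReal_div]
      field_simp; ring
    have h1 := abs_norm_sub_norm_le (mm ℓ b p z) ((U ^ 2 : ℝ) : ℂ)
    rw [e, norm_mul, Complex.norm_real, Complex.norm_real, Real.norm_eq_abs, Real.norm_eq_abs,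
      abs_of_nonneg (sq_nonneg U), ← dist_eq_norm, abs_div, abs_of_pos hs0] at h1
    refine h1.trans ?_
    have h2 : s / |vv b p| ≤ (U ^ 2 / 2) / (97 / 100) := by
      have := hvl p
      gcongr
    calc s / |vv b p| * dist z (vv b p : ℂ) ≤ (U ^ 2 / 2) / (97 / 100) * (4 * u) := by gcongr
      _ = (200 / 97) * (U ^ 2 * u) := by ring
      _ ≤ 3 * U := by rw [hU2u]; linarith
  -- far estimate
  have hX : ∀ p, U - 5 ≤ s * |1 - b| / |vv b p| ∧ s * |1 - b| / |vv b p| ≤ U + 5 := by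
    intro p
    refine far_bounds huU hU hb hs0 hs h ?_
    rw [hvabs]; split_ifs <;> simp
  have hfar : ∀ p z, dist z (vv b (nxt p 2) : ℂ) ≤ u ^ 2 →
      abs (‖mm ℓ b p z‖ - s * |1 - b| / |vv b p|) ≤ 1 := by
    intro p z hz
    have hvc : ((vv b p : ℝ) : ℂ) ≠ 0 := by exact_mod_cast hvn p
    have e : mm ℓ b p z - ((s * (vv b (nxt p 2) + vv b p) / vv b p : ℝ) : ℂ) =
        ((s / vv b p : ℝ) : ℂ) * (z - vv b (nxt p 2)) + ((u ^ 2 : ℝ) : ℂ) := by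
      have : ((u ^ 2 : ℝ) : ℂ) = ((c : ℝ) : ℂ) - ((s : ℝ) : ℂ) := by
        rw [← Complex.ofReal_sub, hc, hs]; congr 1; ring
      unfold mm
      rw [this, ← hsdef, ← hcdef, Complex.ofReal_div, Complex.ofReal_div, Complex.ofReal_mul,
        Complex.ofReal_add]
      field_simp; ring
    have h1 := abs_norm_sub_norm_le (mm ℓ b p z)
      ((s * (vv b (nxt p 2) + vv b p) / vv b p : ℝ) : ℂ)
    rw [e, Complex.norm_real, Real.norm_eq_abs, abs_div, abs_mul, hn2, abs_of_pos hs0] at h1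
    refine h1.trans ((norm_add_le _ _).trans ?_)
    rw [norm_mul, Complex.norm_real, Complex.norm_real, Real.norm_eq_abs, Real.norm_eq_abs,
      abs_of_nonneg (sq_nonneg u), ← dist_eq_norm, abs_div, abs_of_pos hs0]
    have h2 : s / |vv b p| ≤ (U ^ 2 / 2) / (97 / 100) := by
      have := hvl p
      gcongr
    have h3 : s / |vv b p| * dist z (vv b (nxt p 2) : ℂ) ≤ (U ^ 2 / 2) / (97 / 100) * u ^ 2 := by
      gcongr
    have h4 : (U ^ 2 / 2) / (97 / 100) * u ^ 2 = 50 / 97 := by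
      linear_combination (50 / 97) * hU2u2
    linarith
  have hall : ∀ p d z, dist z (vv b (nxt p d) : ℂ) ≤ u ^ 2 →
      (U - 6) ^ bits d ≤ ‖mm ℓ b p z‖ ∧ ‖mm ℓ b p z‖ ≤ (U + 6) ^ bits d := by
    intro p d z hz
    have hnear' : dist z (vv b p : ℂ) ≤ 4 * u →
        (U - 6) ^ 2 ≤ ‖mm ℓ b p z‖ ∧ ‖mm ℓ b p z‖ ≤ (U + 6) ^ 2 := by
      intro hh
      have h1 := abs_le.1 (hnear p z hh)
      constructor <;> nlinarith [h1.1, h1.2]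
    fin_cases d
    · refine hnear' ?_
      have : dist z (vv b p : ℂ) ≤ u ^ 2 := hz
      nlinarith
    · refine hnear' ?_
      have h1 : dist z (vv b (nxt p 1) : ℂ) ≤ u ^ 2 := hz
      have h2 := dist_triangle z (vv b (nxt p 1) : ℂ) (vv b p : ℂ)
      rw [Complex.isometry_ofReal.dist_eq, Real.dist_eq, hn1] at h2
      nlinarith
    · have h1 := abs_le.1 (hfar p z hz)
      have h2 := hX p
      show (U - 6) ^ 1 ≤ _ ∧ _ ≤ (U + 6) ^ 1
      rw [pow_one, pow_one]
      constructor <;> linarith [h1.1, h1.2, h2.1, h2.2]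
  have hcs : Real.cosh (ℓ / 2) - Real.sinh (ℓ / 2) = u ^ 2 := by
    rw [← hcdef, ← hsdef, hc, hs]; ring
  have hmap : ∀ p z, dist z (vv b p : ℂ) ≤ 4 → 4 ≤ ‖mm ℓ b p z‖ →
      dist (ff ℓ b p z) (vv b p : ℂ) ≤ u ^ 2 := by
    intro p z hz hm
    have hm0 : mm ℓ b p z ≠ 0 := norm_pos_iff.1 (by linarith)
    rw [dist_eq_norm, ff_sub_vv ℓ b hb.ne' p z hm0, hcs, norm_div, norm_mul, ← dist_eq_norm,
      Complex.norm_real, Real.norm_eq_abs, abs_of_nonneg (sq_nonneg u), div_le_iff₀ (by linarith)]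
    have := hz.trans hm
    gcongr
  have hvdist : ∀ p q, |vv b p - vv b q| ≤ 3 := by
    intro p q
    have := abs_sub (vv b p) (vv b q)
    linarith [hvu p, hvu q]
  have hvsep : ∀ p q, p ≠ q → 3 / 2 * u ≤ |vv b p - vv b q| := by
    have k1 : 3 / 2 * u ≤ |b - 1| := by rwa [abs_sub_comm]
    have k2 : 3 / 2 * u ≤ |1 + b| := by rw [abs_of_pos (by linarith)]; linarith
    have k3 : 3 / 2 * u ≤ |(2 : ℝ)| := by rw [abs_of_pos (by norm_num)]; linarith
    have k4 : 3 / 2 * u ≤ |b + b| := by rw [abs_of_pos (by linarith)]; linarith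
    have n1 : |-1 + b| = |b - 1| := by congr 1; ring
    have n2 : |-1 - b| = |1 + b| := by rw [← abs_neg]; congr 1; ring
    have n3 : |-b - 1| = |1 + b| := by rw [← abs_neg]; congr 1; ring
    have n4 : |-b + 1| = |1 - b| := by congr 1; ring
    have n5 : |b + 1| = |1 + b| := by congr 1; ring
    have n6 : |-b - b| = |b + b| := by rw [← abs_neg]; congr 1; ring
    have n7 : |(-1 : ℝ) - 1| = |(2 : ℝ)| := by norm_num
    have n8 : |(1 : ℝ) + 1| = |(2 : ℝ)| := by norm_num
    rintro ⟨_ | _, _ | _⟩ ⟨_ | _, _ | _⟩ hpq <;>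
      simp only [vv, ne_eq, not_true_eq_false, Bool.false_eq_true, if_true, if_false, one_mul,
        mul_one, neg_mul, sub_neg_eq_add] at hpq ⊢ <;>
      (try simp only [n1, n2, n3, n4, n5, n6, n7, n8]) <;> assumption
  refine ⟨hb.ne', by positivity, by linarith, by linarith, by linarith, hu, ?_, ?_,
    fun p d z hz => (hall p d z hz).1, fun p d z hz => (hall p d z hz).2, ?_⟩
  · intro p d z hz
    refine hmap p z ?_ ?_
    · have h2 := dist_triangle z (vv b (nxt p d) : ℂ) (vv b p : ℂ)
      rw [Complex.isometry_ofReal.dist_eq, Real.dist_eq] at h2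
      linarith [hvdist (nxt p d) p]
    · refine le_trans ?_ (hall p d z hz).1
      have h1 : (4 : ℝ) ≤ U - 6 := by linarith
      refine h1.trans (le_self_pow₀ (by linarith) ?_)
      have := one_le_bits d; omega
  · intro p
    refine hmap p _ ?_ ?_
    · rw [dist_eq_norm]
      refine (norm_sub_le _ _).trans ?_
      rw [Complex.norm_I, Complex.norm_real, Real.norm_eq_abs]
      linarith [hvu p]
    · have h1 := Complex.abs_re_le_norm (mm ℓ b p Complex.I)
      have h2 : (mm ℓ b p Complex.I).re = c := by
        simp only [mm, Complex.add_re, Complex.mul_re, Complex.ofReal_re, Complex.I_re,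
          Complex.ofReal_im, Complex.I_im]
        rw [← hcdef]; ring
      rw [h2] at h1
      have h3 := le_abs_self c
      nlinarith
  · intro p d d' z w hd hz hw
    have h1 := hvsep (nxt p d) (nxt p d') (fun hh => hd (nxt_inj p d d' hh))
    have h2 := dist_triangle4 (vv b (nxt p d) : ℂ) z w (vv b (nxt p d') : ℂ)
    rw [Complex.isometry_ofReal.dist_eq, Real.dist_eq, dist_comm _ z] at h2
    nlinarith


lemma trace_cond {ℓ a u U : ℝ} (hl : 0 < ℓ) (ha : a ≠ 0) (huU : u * U = 1)
    (hc : Real.cosh (ℓ / 2) = (U ^ 2 + u ^ 2) / 2)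
    (h : 2 * Real.cosh (ℓ / 2) ^ 2 + (a + a⁻¹) * Real.sinh (ℓ / 2) ^ 2
            = -2 * Real.cosh (ℓ / 2)) :
    0 < -a⁻¹ ∧ (1 - (-a⁻¹)) ^ 2 * (U - u) ^ 2 = 4 * (-a⁻¹) := by
  have hs := Real.cosh_sq_sub_sinh_sq (ℓ / 2)
  have hc1 : 1 < Real.cosh (ℓ / 2) := Real.one_lt_cosh.2 (by positivity)
  set c := Real.cosh (ℓ / 2)
  set s := Real.sinh (ℓ / 2)
  have hai : a * a⁻¹ = 1 := mul_inv_cancel₀ ha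
  have hane : a⁻¹ ≠ 0 := inv_ne_zero ha
  set e := a⁻¹
  have h1 : (c + 1) * (2 * c + (a + e) * (c - 1)) = 0 := by
    linear_combination h - (a + e) * (0 - hs)  + 0 * hs
  have h2 : 2 * c + (a + e) * (c - 1) = 0 := by
    rcases mul_eq_zero.1 h1 with h1 | h1
    · linarith
    · exact h1
  have h3 : (U - u) ^ 2 = 2 * (c - 1) := by linear_combination -2 * huU - 2 * hc
  have h4 : (1 - (-e)) ^ 2 * (U - u) ^ 2 = 4 * (-e) := by
    rw [h3]
    linear_combination 2 * e * h2 - 2 * (c - 1) * hai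
  refine ⟨?_, h4⟩
  have : 0 ≤ -e := by nlinarith [mul_nonneg (sq_nonneg (1 - (-e))) (sq_nonneg (U - u))]
  exact lt_of_le_of_ne this (fun h => hane (by linarith))

lemma rpow_half {m : ℝ} (hm : 1 < m) :
    (m ^ 2)⁻¹ ^ (Real.log 2 / (2 * Real.log m)) = 1 / 2 := by
  have hl : 0 < Real.log m := Real.log_pos hm
  have hm0 : 0 < m := by linarith
  rw [Real.rpow_def_of_pos (by positivity), Real.log_inv, Real.log_pow]
  have : -((2 : ℕ) * Real.log m) * (Real.log 2 / (2 * Real.log m)) = -Real.log 2 := by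
    push_cast
    field_simp
  rw [this, Real.exp_neg, Real.exp_log (by norm_num)]
  norm_num

lemma log_diff_bound {x y : ℝ} (hx : 94 ≤ x) (hxy : x ≤ y) :
    Real.log 2 / (2 * Real.log x) - Real.log 2 / (2 * Real.log y) ≤ (y - x) / x := by
  have h1 : 1 ≤ Real.log x := by
    rw [Real.le_log_iff_exp_le (by linarith)]
    have := Real.exp_one_lt_d9
    linarith
  have h2 : Real.log y - Real.log x ≤ (y - x) / x := by
    rw [← Real.log_div (by linarith) (by linarith)]
    have := Real.log_le_sub_one_of_pos (x := y / x) (by apply div_pos <;> linarith)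
    have hx0 : x ≠ 0 := by linarith
    calc _ ≤ _ := this
      _ = _ := by field_simp
  have h3 : Real.log x ≤ Real.log y := Real.log_le_log (by linarith) hxy
  have h4 : 0 ≤ Real.log 2 := Real.log_nonneg (by norm_num)
  have h5 : Real.log 2 ≤ 1 := by have := Real.log_two_lt_d9; linarith
  refine le_trans ?_ h2
  generalize Real.log x = p at *
  generalize Real.log y = q at *
  have hp : 0 < p := by linarith
  have hq : 0 < q := by linarith
  have : Real.log 2 / (2 * p) - Real.log 2 / (2 * q)
      = (Real.log 2 * (q - p)) / (2 * p * q) := by field_simp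
  rw [this, div_le_iff₀ (by positivity)]
  have hpq : 1 ≤ p * q := by nlinarith
  nlinarith [mul_nonneg (sub_nonneg.2 h5) (sub_nonneg.2 h3),
    mul_nonneg (sub_nonneg.2 hpq) (sub_nonneg.2 h3)]

lemma main_bound {ℓ a : ℝ} (hl : 1 ≤ ℓ) (ha : a ≠ 0)
    (h : 2 * Real.cosh (ℓ / 2) ^ 2 + (a + a⁻¹) * Real.sinh (ℓ / 2) ^ 2
            = -2 * Real.cosh (ℓ / 2)) :
    |(dimH (limitSet (threeFunnelGroup ℓ a))).toReal - Real.log 4 / ℓ|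
          ≤ 1000 * Real.exp (-(ℓ / 4)) := by
  have hlog4 : Real.log 4 = 2 * Real.log 2 := by
    rw [show (4 : ℝ) = 2 ^ 2 by norm_num, Real.log_pow]; norm_num
  have hl2 : 0 ≤ Real.log 2 := Real.log_nonneg (by norm_num)
  have hl2' : Real.log 2 ≤ 1 := by have := Real.log_two_lt_d9; linarith
  have hupos := Real.exp_pos (-(ℓ / 4))
  have huU : Real.exp (-(ℓ / 4)) * Real.exp (ℓ / 4) = 1 := by
    rw [← Real.exp_add]; simp
  have hU2 : Real.exp (ℓ / 2) = Real.exp (ℓ / 4) ^ 2 := by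
    rw [← Real.exp_nat_mul]; congr 1; push_cast; ring
  have hu2 : Real.exp (-(ℓ / 2)) = Real.exp (-(ℓ / 4)) ^ 2 := by
    rw [← Real.exp_nat_mul]; congr 1; push_cast; ring
  have hlogU : Real.log (Real.exp (ℓ / 4)) = ℓ / 4 := Real.log_exp _
  set U := Real.exp (ℓ / 4)
  set u := Real.exp (-(ℓ / 4))
  have hc : Real.cosh (ℓ / 2) = (U ^ 2 + u ^ 2) / 2 := by rw [Real.cosh_eq, hU2, hu2]
  have hs : Real.sinh (ℓ / 2) = (U ^ 2 - u ^ 2) / 2 := by rw [Real.sinh_eq, hU2, hu2]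
  by_cases hU : 100 ≤ U
  · obtain ⟨hb, hbe⟩ := trace_cond (by linarith) ha huU hc h
    have hg := good_of huU hU hb hc hs hbe
    have hab : a * (-a⁻¹) = -1 := by rw [mul_neg, mul_inv_cancel₀ ha]
    have hL1 : 0 < Real.log (U - 6) := Real.log_pos (by linarith)
    have hL2 : 0 < Real.log (U + 6) := Real.log_pos (by linarith)
    have hl20 : 0 < Real.log 2 := Real.log_pos (by norm_num)
    have hd1 : 0 < Real.log 2 / (2 * Real.log (U - 6)) := by positivity
    have hd2 : 0 < Real.log 2 / (2 * Real.log (U + 6)) := by positivity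
    obtain ⟨D1, hD1⟩ : ∃ D : NNReal, (D : ℝ) = Real.log 2 / (2 * Real.log (U - 6)) :=
      ⟨⟨_, hd1.le⟩, rfl⟩
    obtain ⟨D2, hD2⟩ : ∃ D : NNReal, (D : ℝ) = Real.log 2 / (2 * Real.log (U + 6)) :=
      ⟨⟨_, hd2.le⟩, rfl⟩
    have hup := upper_bound hg ha hab D1 (by rw [hD1]; exact rpow_half (by linarith))
    have hlo := lower_bound hg ha hab D2 (by rw [← NNReal.coe_pos, hD2]; exact hd2)
      (by rw [hD2]; exact rpow_half (by linarith))
    have hup' := ENNReal.toReal_mono ENNReal.coe_ne_top hup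
    have hlo' := ENNReal.toReal_mono (ne_top_of_le_ne_top ENNReal.coe_ne_top hup) hlo
    rw [ENNReal.coe_toReal, hD1] at hup'
    rw [ENNReal.coe_toReal, hD2] at hlo'
    have hT : Real.log 4 / ℓ = Real.log 2 / (2 * Real.log U) := by
      rw [hlogU, hlog4]; field_simp; ring
    have e1 := log_diff_bound (x := U - 6) (y := U) (by linarith) (by linarith)
    have e2 := log_diff_bound (x := U) (y := U + 6) (by linarith) (by linarith)
    have hu : u = 1 / U := by
      have : U ≠ 0 := by linarith
      field_simp; linarith
    have f1 : (U - (U - 6)) / (U - 6) ≤ 1000 * u := by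
      rw [hu, div_le_iff₀ (by linarith)]
      have : 1000 * (1 / U) * (U - 6) = 1000 - 6000 * (1 / U) := by
        have : U ≠ 0 := by linarith
        field_simp; ring
      rw [this]
      have : 1 / U ≤ 1 / 100 := one_div_le_one_div_of_le (by norm_num) hU
      linarith
    have f2 : (U + 6 - U) / U ≤ 1000 * u := by
      rw [div_le_iff₀ (by linarith)]
      nlinarith
    rw [hT, abs_le]
    constructor <;> linarith
  · push Not at hU
    have hd : dimH (limitSet (threeFunnelGroup ℓ a)) ≤ 1 := by
      have := dimH_mono (Set.subset_univ (limitSet (threeFunnelGroup ℓ a)))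
      rwa [Real.dimH_univ] at this
    have hd' := ENNReal.toReal_mono ENNReal.one_ne_top hd
    rw [ENNReal.toReal_one] at hd'
    have h0 : 0 ≤ (dimH (limitSet (threeFunnelGroup ℓ a))).toReal := ENNReal.toReal_nonneg
    have hT0 : 0 ≤ Real.log 4 / ℓ := by rw [hlog4]; positivity
    have hT1 : Real.log 4 / ℓ ≤ 2 := by
      rw [div_le_iff₀ (by linarith), hlog4]; linarith
    have hu : 1 ≤ 100 * u := by nlinarith
    rw [abs_le]
    constructor <;> linarith

/-- **Theorem 1.1** (first part): exponential error term in McMullen's asymptotics for the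
Hausdorff dimension of the limit set of the symmetric three-funnel Schottky group:
`dimH(L(Γ(ℓ))) = (log 4)/ℓ + O_ε(e^{-(1-ε)ℓ/4})`. -/
theorem hausdorff_dimension_three_funnel :
    ∀ ε ∈ Set.Ioo (0 : ℝ) 1, ∃ C : ℝ, 0 < C ∧
      ∀ ℓ : ℝ, 1 ≤ ℓ → ∀ a : ℝ, a ≠ 0 →
        2 * Real.cosh (ℓ / 2) ^ 2 + (a + a⁻¹) * Real.sinh (ℓ / 2) ^ 2
            = -2 * Real.cosh (ℓ / 2) →
        |(dimH (limitSet (threeFunnelGroup ℓ a))).toReal - Real.log 4 / ℓ|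
          ≤ C * Real.exp (-(1 - ε) * ℓ / 4) := by
  intro ε hε
  refine ⟨1000, by norm_num, fun ℓ hl a ha h => ?_⟩
  refine (main_bound hl ha h).trans ?_
  have : -(ℓ / 4) ≤ -(1 - ε) * ℓ / 4 := by nlinarith [mul_pos hε.1 (by linarith : 0 < ℓ)]
  have := Real.exp_le_exp.2 this
  linarith

end
end

section
/- Let d ≥ 1, ρ ∈ ℂ, ε₀ > 0, and let g(s) = (s−ρ₁)⋯(s−ρ_d) be a monic polynomial all of whose zeros ρ₁,…,ρ_d lie in the open disc D(ρ,ε₀). Let h be holomorphic on D(ρ,3ε₀) and suppose 0 < ε ≤ 4^{−d³−10d}·ε₀^d is such that |h(s)| ≤ ε for all s on the circle |s−ρ| = 2ε₀. Then g+h has exactly d zeros counted with multiplicity in D(ρ,2ε₀); that is, there exist ρ'₁,…,ρ'_d ∈ D(ρ,2ε₀) and a holomorphic function u on D(ρ,2ε₀) with u nonvanishing there such that g(s)+h(s) = u(s)·(s−ρ'₁)⋯(s−ρ'_d) on D(ρ,2ε₀), and the ρ'_j can be ordered so that |ρ_j − ρ'_j| < 4^{d²+3}·ε^{1/d} for each j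 = 1,…,d. -/
open Metric in
lemma zpp_factor (f : ℂ → ℂ) (ρ : ℂ) (R R' : ℝ) (hR : 0 < R) (hRR : R < R')
    (hf : DifferentiableOn ℂ f (ball ρ R')) (w : ℂ) (hw : w ∈ closedBall ρ R) (hfw : f w ≠ 0) :
    ∃ (ι : Type) (_ : Fintype ι) (a : ι → ℂ) (u : ℂ → ℂ),
      AnalyticOnNhd ℂ u (closedBall ρ R) ∧ (∀ s ∈ closedBall ρ R, u s ≠ 0) ∧
      (∀ i, a i ∈ closedBall ρ R) ∧
      ∀ s ∈ closedBall ρ R, f s = u s * ∏ i, (s - a i) := by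
  classical
  set U := closedBall ρ R with hU
  have hconn : IsPreconnected U := (convex_closedBall ρ R).isPreconnected
  have hfa : AnalyticOnNhd ℂ f U :=
    (hf.analyticOnNhd isOpen_ball).mono (closedBall_subset_ball hRR)
  have hm : MeromorphicOn f U := hfa.meromorphicOn
  have hordw : meromorphicOrderAt f w ≠ ⊤ := by
    rw [(hfa w hw).meromorphicOrderAt_eq]
    have : analyticOrderAt f w = 0 := (hfa w hw).analyticOrderAt_eq_zero.2 hfw
    simp [this]
  have hord : ∀ x : U, meromorphicOrderAt f x ≠ ⊤ := fun x =>
    hm.meromorphicOrderAt_ne_top_of_isPreconnected hconn hw x.2 hordw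
  set D := MeromorphicOn.divisor f U with hD
  have hfin : Set.Finite (Function.support D) :=
    D.finiteSupport (isCompact_closedBall ρ R)
  obtain ⟨u, hu, hune, hue⟩ := MeromorphicOn.extract_zeros_poles hm hord hfin
  have hDnn : ∀ x, 0 ≤ D x := fun x => (MeromorphicOn.AnalyticOnNhd.divisor_nonneg hfa) x
  set S := hfin.toFinset with hS
  refine ⟨Σ x : S, Fin (D x).toNat, inferInstance, fun p => p.1, u, hu, fun s hs => hune ⟨s, hs⟩,
    ?_, ?_⟩
  · rintro ⟨⟨x, hx⟩, _⟩
    have hx' : x ∈ Function.support D := by simpa [hS] using hx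
    exact D.supportWithinDomain hx'
  · have hprod : ∀ s : ℂ, (∏ p : (Σ x : S, Fin (D x).toNat), (s - (p.1 : ℂ)))
        = (∏ᶠ x, (· - x) ^ D x : ℂ → ℂ) s := by
      intro s
      rw [Fintype.prod_sigma]
      simp only [Finset.prod_const, Finset.card_univ, Fintype.card_fin]
      rw [finprod_eq_prod_of_mulSupport_subset (s := S)]
      · rw [Finset.prod_apply, Finset.prod_coe_sort S (fun x => (s - x) ^ (D x).toNat)]
        refine Finset.prod_congr rfl fun x _ => ?_
        have := Int.toNat_of_nonneg (hDnn x)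
        simp only [Pi.pow_apply]
        conv_rhs => rw [← this]
        rw [zpow_natCast]
      · intro x hx
        simp only [hS, Set.Finite.coe_toFinset, Function.mem_support]
        intro h0
        apply hx
        simp [h0]
    have hR' : AnalyticOnNhd ℂ (fun s => u s * ∏ p : (Σ x : S, Fin (D x).toNat), (s - (p.1 : ℂ))) U := by
      intro x hx
      refine (hu x hx).mul ?_
      exact Finset.analyticAt_fun_prod _ (fun i _ => by fun_prop)
    have hρ : ρ ∈ U := by simp [hU, hR.le]
    have := hfa.eqOn_of_preconnected_of_frequently_eq hR' hconn hρ ?_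
    · exact this
    · apply Filter.Eventually.frequently
      have h1 := mem_codiscreteWithin_iff_forall_mem_nhdsNE.1 hue ρ hρ
      have h2 : U ∈ nhdsWithin ρ {ρ}ᶜ :=
        mem_nhdsWithin_of_mem_nhds (closedBall_mem_nhds ρ hR)
      filter_upwards [h1, h2] with z hz hzU
      rcases hz with hz | hz
      · rw [hprod, mul_comm]
        exact hz
      · exact absurd hzU hz

open Metric in
lemma zpp_logint {ι : Type} [Fintype ι] (a : ι → ℂ) (u : ℂ → ℂ) (c : ℂ) (r : ℝ) (hr : 0 < r)
    (hu : AnalyticOnNhd ℂ u (closedBall c r)) (hu0 : ∀ s ∈ closedBall c r, u s ≠ 0)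
    (ha : ∀ i, a i ∉ sphere c r) [DecidablePred fun i => a i ∈ ball c r] :
    CircleIntegrable (logDeriv fun s => u s * ∏ i, (s - a i)) c r ∧
    (∮ z in C(c, r), logDeriv (fun s => u s * ∏ i, (s - a i)) z) =
      (Fintype.card {i // a i ∈ ball c r} : ℂ) * (2 * Real.pi * Complex.I) := by
  have hne : ∀ i, ∀ z ∈ sphere c r, z - a i ≠ 0 := fun i z hz h => ha i (by
    rw [← sub_eq_zero.1 h]; exact hz)
  have heq : Set.EqOn (logDeriv fun s => u s * ∏ i, (s - a i))
      (fun z => logDeriv u z + ∑ i, (z - a i)⁻¹) (sphere c r) := by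
    intro z hz
    have hzc := sphere_subset_closedBall hz
    rw [logDeriv_mul z (hu0 z hzc) (Finset.prod_ne_zero_iff.2 fun i _ => hne i z hz)
      (hu z hzc).differentiableAt (by fun_prop)]
    rw [logDeriv_prod (fun i _ => hne i z hz) (fun i _ => by fun_prop)]
    congr 1
    refine Finset.sum_congr rfl fun i _ => ?_
    simp [logDeriv_apply]
  have hlu : AnalyticOnNhd ℂ (logDeriv u) (closedBall c r) := fun z hz =>
    (hu z hz).deriv.div (hu z hz) (hu0 z hz)
  have hI1 : CircleIntegrable (logDeriv u) c r :=
    (hlu.continuousOn.mono sphere_subset_closedBall).circleIntegrable hr.le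
  have hI2 : ∀ i, CircleIntegrable (fun z => (z - a i)⁻¹) c r := fun i =>
    ContinuousOn.circleIntegrable hr.le
      (ContinuousOn.inv₀ (by fun_prop) (hne i))
  have hI3 : CircleIntegrable (fun z => ∑ i, (z - a i)⁻¹) c r :=
    ContinuousOn.circleIntegrable hr.le
      (continuousOn_finsetSum _ fun i _ => ContinuousOn.inv₀ (by fun_prop) (hne i))
  have h0 : (∮ z in C(c, r), logDeriv u z) = 0 :=
    Complex.circleIntegral_eq_zero_of_differentiable_on_off_countable hr.le
      Set.countable_empty hlu.continuousOn
      (fun z hz => (hlu z (ball_subset_closedBall hz.1)).differentiableAt)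
  have h1 : ∀ i, (∮ z in C(c, r), (z - a i)⁻¹) =
      if a i ∈ ball c r then 2 * Real.pi * Complex.I else 0 := by
    intro i
    split_ifs with h
    · exact circleIntegral.integral_sub_inv_of_mem_ball h
    · have hn : ∀ z ∈ closedBall c r, z - a i ≠ 0 := by
        intro z hz h'
        rw [sub_eq_zero] at h'
        subst h'
        rcases (mem_closedBall.1 hz).lt_or_eq with h2 | h2
        · exact h h2
        · exact ha i h2
      refine Complex.circleIntegral_eq_zero_of_differentiable_on_off_countable hr.le
        Set.countable_empty (ContinuousOn.inv₀ (by fun_prop) hn) (fun z hz => ?_)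
      have := hn z (ball_subset_closedBall hz.1)
      fun_prop (disch := assumption)
  constructor
  · exact (hI1.add hI3).congr (fun z hz => (heq (by simpa [abs_of_pos hr] using hz)).symm)
  · rw [circleIntegral.integral_congr hr.le heq, circleIntegral.integral_add hI1 hI3, h0,
      circleIntegral.integral_fun_sum (fun i _ => hI2 i), zero_add]
    simp only [h1]
    rw [Finset.sum_ite, Finset.sum_const, Finset.sum_const_zero, add_zero, nsmul_eq_mul,
      Fintype.card_subtype]

open Metric in
lemma zpp_rouche {ι κ : Type} [Fintype ι] [Fintype κ] (a : ι → ℂ) (b : κ → ℂ) (u h : ℂ → ℂ)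
    (c : ℂ) (r : ℝ) (hr : 0 < r)
    (hu : AnalyticOnNhd ℂ u (closedBall c r)) (hu0 : ∀ s ∈ closedBall c r, u s ≠ 0)
    (hf' : ∀ s ∈ closedBall c r, (∏ j, (s - b j)) + h s = u s * ∏ i, (s - a i))
    (hlt : ∀ s ∈ sphere c r, ‖h s‖ < ‖∏ j, (s - b j)‖)
    [DecidablePred fun i => a i ∈ ball c r] [DecidablePred fun i => b i ∈ ball c r] :
    Fintype.card {i // a i ∈ ball c r} = Fintype.card {i // b i ∈ ball c r} := by
  have hb0 : ∀ s ∈ sphere c r, ∏ j, (s - b j) ≠ 0 := fun s hs h0 => by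
    have := hlt s hs
    rw [h0, norm_zero] at this
    exact absurd this (not_lt.2 (norm_nonneg _))
  have ha0 : ∀ s ∈ sphere c r, u s * ∏ i, (s - a i) ≠ 0 := fun s hs h0 => by
    rw [← hf' s (sphere_subset_closedBall hs)] at h0
    have := hlt s hs
    rw [eq_neg_of_add_eq_zero_left h0, norm_neg] at this
    exact lt_irrefl _ this
  have ha : ∀ i, a i ∉ sphere c r := fun i hi => ha0 _ hi (by
    rw [Finset.prod_eq_zero (Finset.mem_univ i) (sub_self _), mul_zero])
  have hb : ∀ i, b i ∉ sphere c r := fun i hi => hb0 _ hi (by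
    rw [Finset.prod_eq_zero (Finset.mem_univ i) (sub_self _)])
  obtain ⟨hA1, hA2⟩ := zpp_logint a u c r hr hu hu0 ha
  obtain ⟨hB1, hB2⟩ := zpp_logint b (fun _ => 1) c r hr analyticOnNhd_const (by simp) hb
  simp only [one_mul] at hB1 hB2
  have hz : (∮ z in C(c, r), (logDeriv (fun s => u s * ∏ i, (s - a i)) z
      - logDeriv (fun s => ∏ j, (s - b j)) z)) = 0 := by
    refine circleIntegral.integral_eq_zero_of_hasDerivWithinAt (f := fun z =>
      Complex.log ((u z * ∏ i, (z - a i)) / ∏ j, (z - b j))) hr.le (fun z hz => ?_)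
    have hzc := sphere_subset_closedBall hz
    have hdA : DifferentiableAt ℂ (fun s => u s * ∏ i, (s - a i)) z :=
      (hu z hzc).differentiableAt.mul (by fun_prop)
    have hdB : DifferentiableAt ℂ (fun s => ∏ j, (s - b j)) z := by fun_prop
    rw [← logDeriv_div z (ha0 z hz) (hb0 z hz) hdA hdB]
    have hd := (hdA.div hdB (hb0 z hz)).hasDerivAt
    refine (hd.clog ?_).hasDerivWithinAt
    have : (u z * ∏ i, (z - a i)) / ∏ j, (z - b j) = 1 + h z / ∏ j, (z - b j) := by
      rw [← hf' z hzc, add_div, div_self (hb0 z hz)]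
    show (u z * ∏ i, (z - a i)) / ∏ j, (z - b j) ∈ _
    rw [this]
    apply Complex.mem_slitPlane_of_norm_lt_one
    rw [norm_div, div_lt_one (norm_pos_iff.2 (hb0 z hz))]
    exact hlt z hz
  rw [circleIntegral.integral_sub hA1 hB1, hA2, hB2, sub_eq_zero] at hz
  have := mul_right_cancel₀ Complex.two_pi_I_ne_zero hz
  exact_mod_cast this

lemma zpp_gap (d : ℕ) (zs : Fin d → ℂ) (D : ℝ) :
    ∃ k ≤ d ^ 2, ∀ i j, dist (zs i) (zs j) ≤ 4 ^ (k + 1) * D → dist (zs i) (zs j) ≤ 4 ^ k * D := by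
  by_contra! hcon
  obtain ⟨i₀, -⟩ := hcon 0 (Nat.zero_le _)
  have : Nonempty (Fin d) := ⟨i₀⟩
  choose! p q hpq using hcon
  by_cases hD : D < 0
  · have h1 := hpq 0 (Nat.zero_le _)
    have := h1.1
    have h2 : dist (zs (p 0)) (zs (q 0)) ≥ 0 := dist_nonneg
    norm_num at this
    nlinarith
  push Not at hD
  have hmono : ∀ k l, k ≤ d ^ 2 → l ≤ d ^ 2 → k < l → (p k, q k) ≠ (p l, q l) := by
    intro k l hk hl hkl he
    rw [Prod.mk.injEq] at he
    have h1 := (hpq k hk).1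
    have h2 := (hpq l hl).2
    rw [he.1, he.2] at h1
    have : (4 : ℝ) ^ (k + 1) * D ≤ 4 ^ l * D :=
      mul_le_mul_of_nonneg_right (pow_le_pow_right₀ (by norm_num) hkl) hD
    linarith
  have hinj : Function.Injective (fun k : Fin (d ^ 2 + 1) => (p k, q k)) := by
    intro k l hkl
    by_contra hne
    rcases lt_or_gt_of_ne hne with h | h
    · exact hmono k l (by omega) (by omega) h hkl
    · exact hmono l k (by omega) (by omega) h hkl.symm
  have := Fintype.card_le_of_injective _ hinj
  simp only [Fintype.card_fin, Fintype.card_prod] at this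
  nlinarith


/-- **Perturbation of the zeros of a polynomial by a small holomorphic function**
(Lemma 4.8 of the paper). -/
theorem zeros_of_perturbed_polynomial
    (d : ℕ) (hd : 1 ≤ d) (ρ : ℂ) (ε₀ : ℝ) (hε₀ : 0 < ε₀)
    (zs : Fin d → ℂ) (hzs : ∀ j, zs j ∈ Metric.ball ρ ε₀)
    (h : ℂ → ℂ) (hh : DifferentiableOn ℂ h (Metric.ball ρ (3 * ε₀)))
    (ε : ℝ) (hε : 0 < ε) (hεle : ε ≤ ε₀ ^ d / (4 : ℝ) ^ (d ^ 3 + 10 * d))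
    (hbound : ∀ s : ℂ, ‖s - ρ‖ = 2 * ε₀ → ‖h s‖ ≤ ε) :
    ∃ zs' : Fin d → ℂ, (∀ j, zs' j ∈ Metric.ball ρ (2 * ε₀)) ∧
      (∃ u : ℂ → ℂ, DifferentiableOn ℂ u (Metric.ball ρ (2 * ε₀)) ∧
        (∀ s ∈ Metric.ball ρ (2 * ε₀), u s ≠ 0) ∧
        ∀ s ∈ Metric.ball ρ (2 * ε₀),
          (∏ j, (s - zs j)) + h s = u s * ∏ j, (s - zs' j)) ∧
      ∀ j, ‖zs j - zs' j‖ < (4 : ℝ) ^ (d ^ 2 + 3) * ε ^ (1 / (d : ℝ)) := by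
  classical
  set δ : ℝ := ε ^ (1 / (d : ℝ)) with hδ
  have hδ0 : 0 < δ := Real.rpow_pos_of_pos hε _
  have hd0 : d ≠ 0 := by omega
  have hδd : δ ^ d = ε := by
    rw [hδ, one_div]
    exact Real.rpow_inv_natCast_pow hε.le hd0
  have hδle : δ ≤ ε₀ / 4 ^ (d ^ 2 + 10) := by
    refine le_of_pow_le_pow_left₀ hd0 (by positivity) ?_
    rw [hδd, div_pow, ← pow_mul, show (d ^ 2 + 10) * d = d ^ 3 + 10 * d by ring]
    exact hεle
  have hδle' : 4 ^ (d ^ 2 + 10) * δ ≤ ε₀ := by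
    rw [le_div_iff₀ (by positivity)] at hδle
    linarith
  have hbig : 4 ^ (d ^ 2 + 3) * δ ≤ ε₀ :=
    (mul_le_mul_of_nonneg_right (pow_le_pow_right₀ (by norm_num) (by omega)) hδ0.le).trans hδle'
  have hδε : δ < ε₀ := by
    have : (4 : ℝ) ^ 1 * δ ≤ 4 ^ (d ^ 2 + 3) * δ :=
      mul_le_mul_of_nonneg_right (pow_le_pow_right₀ (by norm_num) (by omega)) hδ0.le
    linarith
  have hne : Nonempty (Fin d) := ⟨⟨0, hd⟩⟩
  have hlow : ∀ s : ℂ, (∀ i, δ < ‖s - zs i‖) → ε < ‖∏ i, (s - zs i)‖ := by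
    intro s hs
    rw [norm_prod, ← hδd]
    have := Finset.prod_lt_prod_of_nonempty (s := (Finset.univ : Finset (Fin d)))
      (f := fun _ => δ) (g := fun i => ‖s - zs i‖) (fun _ _ => hδ0) (fun i _ => hs i)
      Finset.univ_nonempty
    simpa using this
  have hsub : Metric.closedBall ρ (2 * ε₀) ⊆ Metric.ball ρ (3 * ε₀) :=
    Metric.closedBall_subset_ball (by linarith)
  have hmax : ∀ s ∈ Metric.closedBall ρ (2 * ε₀), ‖h s‖ ≤ ε := by
    intro s hs
    have hcl : closure (Metric.ball ρ (2 * ε₀)) = Metric.closedBall ρ (2 * ε₀) :=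
      closure_ball ρ (by positivity)
    refine Complex.norm_le_of_forall_mem_frontier_norm_le (U := Metric.ball ρ (2 * ε₀))
      Metric.isBounded_ball ?_ ?_ (by rw [hcl]; exact hs)
    · apply DifferentiableOn.diffContOnCl
      rw [hcl]
      exact hh.mono hsub
    · intro z hz
      rw [frontier_ball ρ (by positivity)] at hz
      exact hbound z (by simpa [dist_eq_norm] using hz)
  have hzs' : ∀ j, dist (zs j) ρ < ε₀ := fun j => hzs j
  -- factorization
  obtain ⟨ι, _, a, u, hu, hu0, ha, hfac⟩ := zpp_factor (fun s => (∏ j, (s - zs j)) + h s) ρ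
    (2 * ε₀) (3 * ε₀) (by positivity) (by linarith)
    (DifferentiableOn.add (by fun_prop) hh) (ρ + (2 * ε₀ : ℝ))
    (by simp [abs_of_pos hε₀]) (by
      intro h0
      have hn : ‖(ρ + (2 * ε₀ : ℝ)) - ρ‖ = 2 * ε₀ := by
        simp [abs_of_pos hε₀]
      have h1 := hbound _ hn
      have h2 := hlow (ρ + (2 * ε₀ : ℝ)) (fun i => by
        have h3 := hzs' i
        rw [dist_eq_norm] at h3
        have := norm_sub_norm_le ((ρ + (2 * ε₀ : ℝ)) - ρ) (zs i - ρ)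
        rw [hn, sub_sub_sub_cancel_right] at this
        linarith)
      rw [eq_neg_of_add_eq_zero_left h0, norm_neg] at h2
      linarith)
  obtain ⟨k, hk, hgap⟩ := zpp_gap d zs (2 * δ)
  set T : ℝ := 4 ^ k * (2 * δ) with hT
  have hTδ : 2 * δ ≤ T := by
    have : (1 : ℝ) ≤ 4 ^ k := one_le_pow₀ (by norm_num)
    nlinarith
  have hgap' : ∀ i j, dist (zs i) (zs j) ≤ 4 * T → dist (zs i) (zs j) ≤ T := by
    intro i j hij
    refine hgap i j (hij.trans (le_of_eq ?_))
    rw [hT, pow_succ]; ring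
  have hTbig : 2 * T < 4 ^ (d ^ 2 + 3) * δ := by
    have h1 : (4 : ℝ) ^ k ≤ 4 ^ (d ^ 2) := pow_le_pow_right₀ (by norm_num) hk
    have h2 : (4 : ℝ) ^ (d ^ 2 + 3) = 64 * 4 ^ (d ^ 2) := by rw [pow_add]; ring
    have h3 : (0 : ℝ) < 4 ^ (d ^ 2) := by positivity
    rw [h2, hT]
    nlinarith [mul_le_mul_of_nonneg_right h1 hδ0.le, mul_pos h3 hδ0]
  let R : Setoid (Fin d) :=
    { r := fun i j => dist (zs i) (zs j) ≤ T
      iseqv := ⟨fun i => by rw [dist_self]; linarith, fun {i j} hij => by rw [dist_comm]; exact hij,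
        fun {i j l} hij hjl => hgap' _ _ (by
          have := dist_triangle (zs i) (zs j) (zs l)
          linarith)⟩ }
  have hRiff : ∀ i j, (Quotient.mk R i = Quotient.mk R j) ↔ dist (zs i) (zs j) ≤ T :=
    fun i j => Quotient.eq
  have hnear : ∀ b, ∃ j, dist (a b) (zs j) ≤ δ := by
    intro b
    by_contra! hc
    have h1 := hlow (a b) (fun i => by rw [← dist_eq_norm]; exact hc i)
    have h2 := hfac (a b) (ha b)
    rw [Finset.prod_eq_zero (Finset.mem_univ b) (sub_self _), mul_zero] at h2
    rw [eq_neg_of_add_eq_zero_left h2, norm_neg] at h1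
    exact absurd (hmax _ (ha b)) (not_le.2 h1)
  choose n hn using hnear
  have hqa : ∀ b i, Quotient.mk R (n b) = Quotient.mk R i ↔ a b ∈ Metric.ball (zs i) (2 * T) := by
    intro b i
    rw [hRiff, Metric.mem_ball]
    constructor
    · intro h1
      have := dist_triangle (a b) (zs (n b)) (zs i)
      linarith [hn b]
    · intro h1
      apply hgap'
      have := dist_triangle_left (zs (n b)) (zs i) (a b)
      linarith [hn b]
  have hqz : ∀ j i, Quotient.mk R j = Quotient.mk R i ↔ zs j ∈ Metric.ball (zs i) (2 * T) := by
    intro j i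
    rw [hRiff, Metric.mem_ball]
    constructor
    · intro h1
      linarith
    · intro h1
      apply hgap'
      linarith
  have hcard : ∀ i, Fintype.card {b // a b ∈ Metric.ball (zs i) (2 * T)} =
      Fintype.card {j // zs j ∈ Metric.ball (zs i) (2 * T)} := by
    intro i
    have hs : Metric.closedBall (zs i) (2 * T) ⊆ Metric.closedBall ρ (2 * ε₀) :=
      Metric.closedBall_subset_closedBall' (by linarith [hzs' i])
    refine zpp_rouche a zs u h (zs i) (2 * T) (by linarith) (hu.mono hs)
      (fun s hs' => hu0 s (hs hs')) (fun s hs' => hfac s (hs hs')) (fun s hs' => ?_)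
    refine (hmax s (hs (Metric.sphere_subset_closedBall hs'))).trans_lt (hlow s fun j => ?_)
    rw [← dist_eq_norm]
    rw [Metric.mem_sphere] at hs'
    by_contra! hc
    have h1 : dist (zs i) (zs j) ≤ T := hgap' _ _ (by
      have := dist_triangle_left (zs i) (zs j) s
      linarith)
    have := dist_triangle_right s (zs i) (zs j)
    linarith
  have hfib : ∀ c : Quotient R, Nonempty ({j // Quotient.mk R j = c} ≃
      {b // Quotient.mk R (n b) = c}) := by
    intro c
    induction c using Quotient.inductionOn with
    | h i =>
      refine ⟨(Equiv.subtypeEquivRight fun j => hqz j i).trans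
        ((Fintype.equivOfCardEq (hcard i).symm).trans
        (Equiv.subtypeEquivRight fun b => hqa b i).symm)⟩
  let e : Fin d ≃ ι := Equiv.ofFiberEquiv (f := fun j => Quotient.mk R j)
    (g := fun b => Quotient.mk R (n b)) (fun c => (hfib c).some)
  have he : ∀ j, Quotient.mk R (n (e j)) = Quotient.mk R j := fun j =>
    Equiv.ofFiberEquiv_map (f := fun j => Quotient.mk R j)
      (g := fun b => Quotient.mk R (n b)) (fun c => (hfib c).some) j
  refine ⟨fun j => a (e j), fun j => ?_, ⟨u, ?_, ?_, ?_⟩, fun j => ?_⟩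
  · rw [Metric.mem_ball]
    have := dist_triangle (a (e j)) (zs (n (e j))) ρ
    linarith [hn (e j), hzs' (n (e j))]
  · exact hu.differentiableOn.mono Metric.ball_subset_closedBall
  · exact fun s hs => hu0 s (Metric.ball_subset_closedBall hs)
  · intro s hs
    rw [hfac s (Metric.ball_subset_closedBall hs), Equiv.prod_comp e (fun b => s - a b)]
  · have h1 := (hqa (e j) j).1 (he j)
    rw [Metric.mem_ball, dist_comm, dist_eq_norm] at h1
    linarith
end

section
/- Let (V, E, o, t, ι, h) be a finite weighted directed graph as in the context, with edge matrix W(s). Then there exists σ₀ ∈ ℝ such that for every s ∈ ℂ with Re s > σ₀, the family (1 − e^{−s·ℓ_h(P)}), indexed by equivalence classes [P] of primitive non-backtracking loops, is multipliable, and its product equals det(I − W(s)). In particular, the weighted Ihara zeta function Z_I(G,h,s) = ∏_{[P]} (1 − e^{−s·ℓ_h(P)}) extends to an entire function of s. -/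
noncomputable section

/-- `P` (with period `n`) is a non-backtracking closed loop of length `n` in the graph with
origin/terminus maps `o, t` and edge-reversal `ι`. -/
def IsLoop {V E : Type} (o t : E → V) (ι : E → E) (n : ℕ) (P : ℕ → E) : Prop :=
  0 < n ∧ (∀ i, P (i + n) = P i) ∧ (∀ i, t (P i) = o (P (i + 1))) ∧
    (∀ i, P (i + 1) ≠ ι (P i))

/-- A primitive non-backtracking loop: not the repetition of a shorter loop. -/
def IsPrimLoop {V E : Type} (o t : E → V) (ι : E → E) (n : ℕ) (P : ℕ → E) : Prop :=
  IsLoop o t ι n P ∧ ∀ d : ℕ, d ∣ n → d < n → ¬ (∀ i, P (i + d) = P i)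

/-- The weighted length `ℓ_h(P) = Σ_{i<n} h(P(i))` of a loop of length `n`. -/
def wlen {E : Type} (h : E → ℝ) (n : ℕ) (P : ℕ → E) : ℝ :=
  ∑ i ∈ Finset.range n, h (P i)

/-- Two primitive loops are equivalent if they have the same length and one is a rotation of
the other. -/
def LoopRel {V E : Type} (o t : E → V) (ι : E → E)
    (x y : {p : ℕ × (ℕ → E) // IsPrimLoop o t ι p.1 p.2}) : Prop :=
  x.1.1 = y.1.1 ∧ ∃ r : ℕ, ∀ i, y.1.2 i = x.1.2 (i + r)

/-- The set of equivalence classes of primitive non-backtracking loops. -/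
def LoopClasses {V E : Type} (o t : E → V) (ι : E → E) : Type :=
  Quot (LoopRel o t ι)

/-- The weighted length of a class of primitive loops (`ℓ_h` is rotation-invariant, so it is
recovered as the infimum over representatives). -/
def classWlen {V E : Type} (o t : E → V) (ι : E → E) (h : E → ℝ)
    (c : LoopClasses o t ι) : ℝ :=
  sInf {r : ℝ | ∃ p : {p : ℕ × (ℕ → E) // IsPrimLoop o t ι p.1 p.2},
    Quot.mk (LoopRel o t ι) p = c ∧ r = wlen h p.1.1 p.1.2}

/-- The edge matrix `W(s)` of the weighted graph:
`W(s)_{e,e'} = e^{-s(h(e)+h(e'))/2}` if `t(e) = o(e')` and `e' ≠ ι(e)`, else `0`. -/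
def edgeMatrix {V E : Type} [DecidableEq V] [DecidableEq E]
    (o t : E → V) (ι : E → E) (h : E → ℝ) (s : ℂ) : Matrix E E ℂ :=
  Matrix.of fun e e' =>
    if t e = o e' ∧ e' ≠ ι e then Complex.exp (-s * (((h e + h e') / 2 : ℝ) : ℂ)) else 0

open Polynomial in
theorem det_aeval_eq {n : Type*} [Fintype n] [DecidableEq n] (A : Matrix n n ℂ) (p : ℂ[X]) :
    (aeval A p).det = (A.charpoly.roots.map (fun x => p.eval x)).prod := by
  have hcard : A.charpoly.roots.card = Fintype.card n := by
    rw [← (IsAlgClosed.splits A.charpoly).natDegree_eq_card_roots, Matrix.charpoly_natDegree_eq_dim]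
  have hlin : ∀ a : ℂ, (aeval A (X - C a)).det = (A.charpoly.roots.map (fun x => (X - C a).eval x)).prod := by
    intro a
    have h1 : aeval A (X - C a) = -(Matrix.scalar n a - A) := by
      simp [Matrix.algebraMap_eq_diagonal]
    have h2 := (IsAlgClosed.splits A.charpoly).eq_prod_roots_of_monic A.charpoly_monic
    have h3 : A.charpoly.eval a = (A.charpoly.roots.map (fun x => a - x)).prod := by
      conv_lhs => rw [h2]
      rw [Polynomial.eval_multiset_prod, Multiset.map_map]
      simp
    rw [h1, Matrix.det_neg, ← Matrix.eval_charpoly, h3, ← hcard,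
      ← Multiset.card_map (fun x => a - x), ← Multiset.prod_map_neg, Multiset.map_map]
    simp
  have hmul : ∀ S : Multiset ℂ, (aeval A ((S.map (fun a => X - C a)).prod)).det =
      (A.charpoly.roots.map (fun x => ((S.map (fun a => X - C a)).prod).eval x)).prod := by
    intro S
    induction S using Multiset.induction with
    | empty => simp
    | cons a S ih =>
      simp only [Multiset.map_cons, Multiset.prod_cons, map_mul, Matrix.det_mul, ih, hlin,
        eval_mul, Multiset.prod_map_mul]
  have hp := (IsAlgClosed.splits p).eq_prod_roots
  rw [hp, map_mul, Matrix.det_mul, hmul]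
  simp only [eval_mul, Multiset.prod_map_mul, eval_C]
  simp [Matrix.algebraMap_eq_diagonal, hcard]

open Polynomial in
theorem charpoly_pow_roots {n : Type*} [Fintype n] [DecidableEq n] (A : Matrix n n ℂ) (k : ℕ) :
    (A ^ k).charpoly.roots = A.charpoly.roots.map (fun x => x ^ k) := by
  have : (A ^ k).charpoly = ((A.charpoly.roots.map (fun x => x ^ k)).map (fun a => X - C a)).prod := by
    apply Polynomial.funext
    intro x
    have h := det_aeval_eq A (C x - X ^ k)
    rw [Matrix.eval_charpoly, Polynomial.eval_multiset_prod]
    simp only [Multiset.map_map, Function.comp_def]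
    simp only [eval_sub, eval_pow, eval_X, eval_C] at h ⊢
    rw [← h]
    simp [Matrix.algebraMap_eq_diagonal]
    rfl
  rw [this, roots_multiset_prod_X_sub_C]

theorem mset_log (S : Multiset ℂ) (hS : ∀ x ∈ S, ‖x‖ < 1) :
    ∃ L : ℂ, HasSum (fun n : ℕ => (S.map (fun x => x ^ (n+1))).sum / ((n : ℂ) + 1)) L ∧
      Complex.exp (-L) = (S.map (fun x => 1 - x)).prod := by
  induction S using Multiset.induction with
  | empty => exact ⟨0, by simp, by simp⟩
  | cons a S ih =>
    obtain ⟨L, hL, he⟩ := ih (fun x hx => hS x (Multiset.mem_cons_of_mem hx))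
    have ha := hS a (Multiset.mem_cons_self a S)
    refine ⟨-Complex.log (1 - a) + L, ?_, ?_⟩
    · simp only [Multiset.map_cons, Multiset.sum_cons, add_div]
      exact (Complex.hasSum_taylorSeries_neg_log' ha).add hL
    · have : (1 - a) ≠ 0 := by
        intro h
        rw [sub_eq_zero] at h
        rw [← h] at ha
        simp at ha
      rw [neg_add, neg_neg, Complex.exp_add, Complex.exp_log this, he]
      simp

theorem det_one_sub_eq_exp {n : Type*} [Fintype n] [DecidableEq n] (A : Matrix n n ℂ) (q : ℝ)
    (hq : ∀ i j, ‖A i j‖ ≤ q) (hq1 : Fintype.card n * q < 1) :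
    ∃ L : ℂ, HasSum (fun k : ℕ => (A ^ (k+1)).trace / ((k : ℂ) + 1)) L ∧
      Complex.exp (-L) = (1 - A).det := by
  have hroots : ∀ x ∈ A.charpoly.roots, ‖x‖ < 1 := by
    intro x hx
    have hx' := Matrix.mem_spectrum_iff_isRoot_charpoly.2 (Polynomial.isRoot_of_mem_roots hx)
    rw [← Matrix.spectrum_toLin', ← Module.End.hasEigenvalue_iff_mem_spectrum] at hx'
    obtain ⟨k, hk⟩ := eigenvalue_mem_ball hx'
    rw [mem_closedBall_iff_norm] at hk
    calc ‖x‖ = ‖(x - A k k) + A k k‖ := by simp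
      _ ≤ ‖x - A k k‖ + ‖A k k‖ := norm_add_le _ _
      _ ≤ ∑ j ∈ Finset.univ.erase k, ‖A k j‖ + ‖A k k‖ := by gcongr
      _ = ∑ j, ‖A k j‖ := Finset.sum_erase_add _ _ (Finset.mem_univ k)
      _ ≤ ∑ j : n, q := Finset.sum_le_sum fun j _ => hq k j
      _ = Fintype.card n * q := by simp
      _ < 1 := hq1
  obtain ⟨L, hL, he⟩ := mset_log _ hroots
  refine ⟨L, ?_, ?_⟩
  · convert hL using 3 with k
    rw [Matrix.trace_eq_sum_roots_charpoly, charpoly_pow_roots]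
  · rw [he]
    have := det_aeval_eq A (1 - Polynomial.X)
    simpa using this.symm

theorem pow_succ_path {n : Type*} [Fintype n] [DecidableEq n] (A : Matrix n n ℂ) (k : ℕ) (a b : n) :
    (A ^ (k+1)) a b = ∑ f : Fin k → n, ∏ i : Fin (k+1),
      A ((Fin.cons a f : Fin (k+1) → n) i) ((Fin.snoc f b : Fin (k+1) → n) i) := by
  induction k generalizing a with
  | zero => simp [Fin.snoc]
  | succ k ih =>
    rw [pow_succ', Matrix.mul_apply, ← (Fin.consEquiv (fun _ : Fin (k+1) => n)).sum_comp,
      Fintype.sum_prod_type]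
    refine Finset.sum_congr rfl fun c _ => ?_
    rw [ih, Finset.mul_sum]
    refine Finset.sum_congr rfl fun f _ => ?_
    have e : (Fin.consEquiv (fun _ : Fin (k+1) => n)) (c, f) = (Fin.cons c f : Fin (k+1) → n) := rfl
    rw [Fin.prod_univ_succ (n := k+1), e, ← Fin.cons_snoc_eq_snoc_cons]
    simp only [Fin.cons_zero, Fin.cons_succ]

theorem trace_pow_cyc {n : Type*} [Fintype n] [DecidableEq n] (A : Matrix n n ℂ) (k : ℕ) :
    (A ^ (k+1)).trace = ∑ f : Fin (k+1) → n, ∏ i : Fin (k+1), A (f i) (f (i+1)) := by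
  rw [← (Fin.consEquiv (fun _ : Fin (k+1) => n)).sum_comp, Fintype.sum_prod_type, Matrix.trace]
  refine Finset.sum_congr rfl fun a _ => ?_
  rw [Matrix.diag_apply, pow_succ_path]
  refine Finset.sum_congr rfl fun f _ => ?_
  refine Finset.prod_congr rfl fun i _ => ?_
  simp only [Fin.consEquiv_apply]
  congr 1
  induction i using Fin.lastCases with
  | last => simp
  | cast i => simp

/-- Shift of a sequence. -/
def seqShift {E : Type} (P : ℕ → E) : ℕ → E := fun i => P (i + 1)

theorem seqShift_iter {E : Type} (r : ℕ) (P : ℕ → E) (i : ℕ) :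
    (seqShift^[r] P) i = P (i + r) := by
  induction r generalizing i with
  | zero => rfl
  | succ r ih =>
    rw [Function.iterate_succ_apply', seqShift, ih]
    congr 1
    omega

theorem isPeriodicPt_iff {E : Type} (n : ℕ) (P : ℕ → E) :
    Function.IsPeriodicPt seqShift n P ↔ ∀ i, P (i + n) = P i := by
  rw [Function.IsPeriodicPt, Function.IsFixedPt, funext_iff]
  simp only [seqShift_iter]

theorem prim_minimalPeriod {V E : Type} {o t : E → V} {ι : E → E} {n : ℕ} {P : ℕ → E}
    (hP : IsPrimLoop o t ι n P) : Function.minimalPeriod seqShift P = n := by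
  have h1 : Function.IsPeriodicPt seqShift n P := (isPeriodicPt_iff n P).2 hP.1.2.1
  by_contra hne
  have hle := h1.minimalPeriod_le hP.1.1
  exact hP.2 _ h1.minimalPeriod_dvd (lt_of_le_of_ne hle hne)
    ((isPeriodicPt_iff _ P).1 (Function.isPeriodicPt_minimalPeriod seqShift P))

theorem isPrimLoop_shift {V E : Type} {o t : E → V} {ι : E → E} {n : ℕ} {P : ℕ → E}
    (hP : IsPrimLoop o t ι n P) (r : ℕ) : IsPrimLoop o t ι n (seqShift^[r] P) := by
  obtain ⟨⟨h0, h1, h2, h3⟩, h4⟩ := hP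
  refine ⟨⟨h0, ?_, ?_, ?_⟩, ?_⟩
  · intro i
    simp only [seqShift_iter]
    rw [← h1 (i + r)]
    congr 1
    omega
  · intro i
    simp only [seqShift_iter]
    rw [h2, show i + r + 1 = i + 1 + r by omega]
  · intro i
    simp only [seqShift_iter]
    rw [show i + 1 + r = i + r + 1 by omega]
    exact h3 _
  · intro d hd hdn hper
    apply h4 d hd hdn
    have hp : Function.IsPeriodicPt seqShift d (seqShift^[r] P) := (isPeriodicPt_iff _ _).2 hper
    have h5 : ∀ k, P (k + n * r) = P k := by
      intro k
      have : Function.IsPeriodicPt seqShift (n * r) P :=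
        ((isPeriodicPt_iff n P).2 h1).mul_const r
      exact (isPeriodicPt_iff _ P).1 this k
    intro i
    have hle : r ≤ n * r := Nat.le_mul_of_pos_left r h0
    have h6 := hper (i + (n * r - r))
    simp only [seqShift_iter] at h6
    rw [← h5 (i + d), ← h5 i]
    convert h6 using 2 <;> omega

theorem loopRel_equiv {V E : Type} (o t : E → V) (ι : E → E) :
    Equivalence (LoopRel o t ι) := by
  refine ⟨fun x => ⟨rfl, 0, fun i => rfl⟩, ?_, ?_⟩
  · rintro x y ⟨hn, r, hr⟩
    refine ⟨hn.symm, x.1.1 * r - r, fun i => ?_⟩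
    have hle : r ≤ x.1.1 * r := Nat.le_mul_of_pos_left r x.2.1.1
    have : Function.IsPeriodicPt seqShift (x.1.1 * r) x.1.2 :=
      ((isPeriodicPt_iff _ _).2 x.2.1.2.1).mul_const r
    refine ((isPeriodicPt_iff _ _).1 this i).symm.trans ?_
    rw [hr, show i + (x.1.1 * r - r) + r = i + x.1.1 * r by omega]
  · rintro x y z ⟨hn, r, hr⟩ ⟨hm, q, hq⟩
    refine ⟨hn.trans hm, q + r, fun i => ?_⟩
    rw [hq, hr, add_assoc]

theorem loopRel_of_mk_eq {V E : Type} {o t : E → V} {ι : E → E}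
    {x y : {p : ℕ × (ℕ → E) // IsPrimLoop o t ι p.1 p.2}}
    (hxy : Quot.mk (LoopRel o t ι) x = Quot.mk (LoopRel o t ι) y) : LoopRel o t ι x y :=
  (loopRel_equiv o t ι).eqvGen_iff.1 (Quot.eqvGen_exact hxy)

theorem wlen_shift {E : Type} (h : E → ℝ) (n : ℕ) (P : ℕ → E) (hP : ∀ i, P (i + n) = P i) (r : ℕ) :
    ∑ i ∈ Finset.range n, h (P (i + r)) = wlen h n P := by
  induction r with
  | zero => rfl
  | succ r ih =>
    rw [← ih]
    have e1 := Finset.sum_range_succ (fun i => h (P (i + r))) n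
    have e2 := Finset.sum_range_succ' (fun i => h (P (i + r))) n
    rw [e1] at e2
    have e3 : P (n + r) = P (0 + r) := by rw [add_comm n r, hP, zero_add]
    rw [e3] at e2
    have e4 := add_right_cancel e2
    rw [e4]
    refine Finset.sum_congr rfl fun i _ => ?_
    congr 2
    omega

theorem wlen_mul {E : Type} (h : E → ℝ) (n : ℕ) (P : ℕ → E) (hP : ∀ i, P (i + n) = P i) (k : ℕ) :
    wlen h (n * k) P = k * wlen h n P := by
  induction k with
  | zero => simp [wlen]
  | succ k ih =>
    have : Function.IsPeriodicPt seqShift (n * k) P := ((isPeriodicPt_iff _ _).2 hP).mul_const k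
    have h2 := (isPeriodicPt_iff _ _).1 this
    rw [mul_add, mul_one, wlen, Finset.sum_range_add]
    rw [wlen] at ih
    rw [ih]
    have : ∑ x ∈ Finset.range n, h (P (n * k + x)) = wlen h n P := by
      refine Finset.sum_congr rfl fun i _ => ?_
      rw [add_comm, h2]
    rw [this]
    push_cast
    ring

theorem classWlen_mk {V E : Type} (o t : E → V) (ι : E → E) (h : E → ℝ)
    (p : {p : ℕ × (ℕ → E) // IsPrimLoop o t ι p.1 p.2}) :
    classWlen o t ι h (Quot.mk _ p) = wlen h p.1.1 p.1.2 := by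
  have : {r : ℝ | ∃ q : {p : ℕ × (ℕ → E) // IsPrimLoop o t ι p.1 p.2},
    Quot.mk (LoopRel o t ι) q = Quot.mk _ p ∧ r = wlen h q.1.1 q.1.2} = {wlen h p.1.1 p.1.2} := by
    ext r
    simp only [Set.mem_ofPred_eq, Set.mem_singleton_iff]
    constructor
    · rintro ⟨q, hq, rfl⟩
      obtain ⟨hn, r, hr⟩ := loopRel_of_mk_eq hq.symm
      rw [← hn, ← wlen_shift h p.1.1 p.1.2 p.2.1.2.1 r]
      refine Finset.sum_congr rfl fun i _ => ?_
      rw [hr]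
    · rintro rfl
      exact ⟨p, rfl, rfl⟩
  exact (congrArg sInf this).trans (csInf_singleton _)

theorem fiber_equiv {V E : Type} {o t : E → V} {ι : E → E}
    (p : {p : ℕ × (ℕ → E) // IsPrimLoop o t ι p.1 p.2}) :
    Nonempty (Fin p.1.1 ≃ {q : {p : ℕ × (ℕ → E) // IsPrimLoop o t ι p.1 p.2} //
      Quot.mk (LoopRel o t ι) q = Quot.mk (LoopRel o t ι) p}) := by
  refine ⟨Equiv.ofBijective (fun r => ⟨⟨(p.1.1, seqShift^[r.1] p.1.2), isPrimLoop_shift p.2 r.1⟩,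
    (Quot.sound ⟨rfl, r.1, fun i => seqShift_iter _ _ _⟩).symm⟩) ⟨?_, ?_⟩⟩
  · intro a b hab
    simp only [Subtype.mk.injEq, Prod.mk.injEq, true_and] at hab
    have hm := prim_minimalPeriod p.2
    apply Fin.ext
    exact Function.iterate_injOn_Iio_minimalPeriod (by rw [hm]; exact a.2) (by rw [hm]; exact b.2) hab
  · rintro ⟨q, hq⟩
    obtain ⟨hn, r, hr⟩ := loopRel_of_mk_eq hq.symm
    refine ⟨⟨r % p.1.1, Nat.mod_lt _ p.2.1.1⟩, ?_⟩
    apply Subtype.ext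
    apply Subtype.ext
    refine Prod.ext hn ?_
    funext i
    have := Function.iterate_mod_minimalPeriod_eq (f := seqShift) (x := p.1.2) (n := r)
    rw [prim_minimalPeriod p.2] at this
    have e : (seqShift^[r % p.1.1] p.1.2) i = p.1.2 (i + r) := by rw [this, seqShift_iter]
    exact e.trans (hr i).symm

/-- Periodic extension of a cyclic word. -/
def cycExt {E : Type} (x : Σ k : ℕ, (Fin (k+1) → E)) : ℕ × (ℕ → E) :=
  (x.1 + 1, fun i => x.2 (Fin.ofNat (x.1+1) i))

theorem cycExt_inj {E : Type} : Function.Injective (cycExt (E := E)) := by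
  rintro ⟨k, f⟩ ⟨l, g⟩ hxy
  simp only [cycExt, Prod.mk.injEq] at hxy
  obtain ⟨h1, h2⟩ := hxy
  obtain rfl : k = l := by omega
  congr 1
  funext i
  simpa using congrFun h2 i.1

theorem cycExt_prod {E : Type} (W : Matrix E E ℂ) (x : Σ k : ℕ, (Fin (k+1) → E)) :
    ∏ i, W (x.2 i) (x.2 (i+1)) =
      ∏ i ∈ Finset.range (cycExt x).1, W ((cycExt x).2 i) ((cycExt x).2 (i+1)) := by
  obtain ⟨k, f⟩ := x
  simp only [cycExt, Finset.prod_range]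
  refine Finset.prod_congr rfl fun i _ => ?_
  congr 2
  · simp
  · apply Fin.ext
    simp [Fin.val_add]

theorem cycExt_period {E : Type} (x : Σ k : ℕ, (Fin (k+1) → E)) (i : ℕ) :
    (cycExt x).2 (i + (cycExt x).1) = (cycExt x).2 i := by
  simp only [cycExt]
  have : Fin.ofNat (x.1 + 1) (i + (x.1 + 1)) = Fin.ofNat (x.1 + 1) i := Fin.ext (by simp)
  rw [this]

/-- Words from prime loops and multiplicities. -/
def primWord {V E : Type} (o t : E → V) (ι : E → E)
    (x : {p : ℕ × (ℕ → E) // IsPrimLoop o t ι p.1 p.2} × ℕ) : Σ k : ℕ, (Fin (k+1) → E) :=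
  ⟨x.1.1.1 * (x.2 + 1) - 1, fun i => x.1.1.2 i.1⟩

theorem cycExt_primWord {V E : Type} {o t : E → V} {ι : E → E}
    (x : {p : ℕ × (ℕ → E) // IsPrimLoop o t ι p.1 p.2} × ℕ) :
    cycExt (primWord o t ι x) = (x.1.1.1 * (x.2 + 1), x.1.1.2) := by
  have h0 : 0 < x.1.1.1 * (x.2 + 1) := Nat.mul_pos x.1.2.1.1 (Nat.succ_pos _)
  have h1 : x.1.1.1 * (x.2 + 1) - 1 + 1 = x.1.1.1 * (x.2 + 1) := by omega
  refine Prod.ext h1 ?_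
  funext i
  show x.1.1.2 (i % (x.1.1.1 * (x.2 + 1) - 1 + 1)) = x.1.1.2 i
  rw [h1]
  have hp : Function.IsPeriodicPt seqShift (x.1.1.1 * (x.2 + 1)) x.1.1.2 :=
    ((isPeriodicPt_iff _ _).2 x.1.2.1.2.1).mul_const _
  have := congrFun (hp.iterate_mod_apply i) 0
  simpa [seqShift_iter] using this

theorem primWord_inj {V E : Type} {o t : E → V} {ι : E → E} :
    Function.Injective (primWord o t ι) := by
  rintro ⟨⟨⟨n, P⟩, hP⟩, k⟩ ⟨⟨⟨m, Q⟩, hQ⟩, l⟩ hxy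
  have := congrArg cycExt hxy
  rw [cycExt_primWord, cycExt_primWord] at this
  simp only [Prod.mk.injEq] at this
  obtain ⟨h1, rfl⟩ := this
  have hn := prim_minimalPeriod hP
  have hm := prim_minimalPeriod hQ
  simp only at hn hm
  obtain rfl : n = m := hn.symm.trans hm
  have := Nat.eq_of_mul_eq_mul_left hP.1.1 h1
  simp only [Prod.mk.injEq, true_and]
  omega

theorem primWord_range {V E : Type} [DecidableEq V] [DecidableEq E] (o t : E → V) (ι : E → E)
    (h : E → ℝ) (s : ℂ) (x : Σ k : ℕ, (Fin (k+1) → E))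
    (hx : ∏ i, edgeMatrix o t ι h s (x.2 i) (x.2 (i+1)) ≠ 0) :
    x ∈ Set.range (primWord o t ι) := by
  rw [cycExt_prod] at hx
  set N := (cycExt x).1 with hN
  set P := (cycExt x).2 with hPdef
  have hN0 : 0 < N := Nat.succ_pos _
  have hper : ∀ i, P (i + N) = P i := cycExt_period x
  have hpp : Function.IsPeriodicPt seqShift N P := (isPeriodicPt_iff _ _).2 hper
  have hadj : ∀ i, t (P i) = o (P (i+1)) ∧ P (i+1) ≠ ι (P i) := by
    intro i
    have h1 := Finset.prod_ne_zero_iff.1 hx (i % N) (Finset.mem_range.2 (Nat.mod_lt _ hN0))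
    have h2 : ∀ j, P (i % N + j) = P (i + j) := by
      intro j
      have := congrFun (hpp.iterate_mod_apply i) j
      simp only [seqShift_iter] at this
      rw [add_comm, this, add_comm]
    have h20 := h2 0
    rw [add_zero, add_zero] at h20
    rw [h2, h20] at h1
    by_contra hcon
    apply h1
    rw [edgeMatrix, Matrix.of_apply, if_neg hcon]
  obtain ⟨k, hk⟩ := hpp.minimalPeriod_dvd
  set d := Function.minimalPeriod seqShift P with hd
  have hk0 : k ≠ 0 := by
    rintro rfl
    omega
  have hd0 : 0 < d := hpp.minimalPeriod_pos hN0
  have hprim : IsPrimLoop o t ι d P := by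
    refine ⟨⟨hd0, (isPeriodicPt_iff _ _).1 (Function.isPeriodicPt_minimalPeriod seqShift P),
      fun i => (hadj i).1, fun i => (hadj i).2⟩, ?_⟩
    intro e hed hlt hper
    have he0 : 0 < e := Nat.pos_of_dvd_of_pos hed hd0
    have := ((isPeriodicPt_iff e P).2 hper).minimalPeriod_le he0
    omega
  refine ⟨(⟨(d, P), hprim⟩, k - 1), ?_⟩
  apply cycExt_inj
  rw [cycExt_primWord]
  refine Prod.ext ?_ rfl
  show d * (k - 1 + 1) = N
  rw [hk, Nat.sub_add_cancel (Nat.pos_of_ne_zero hk0)]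

theorem loop_prod {V E : Type} [DecidableEq V] [DecidableEq E] (o t : E → V) (ι : E → E)
    (h : E → ℝ) (s : ℂ) (n : ℕ) (P : ℕ → E) (hP : IsLoop o t ι n P) :
    ∏ i ∈ Finset.range n, edgeMatrix o t ι h s (P i) (P (i+1)) =
      Complex.exp (-s * (wlen h n P : ℂ)) := by
  obtain ⟨h0, h1, h2, h3⟩ := hP
  have : wlen h n P = ∑ i ∈ Finset.range n, (h (P i) + h (P (i+1))) / 2 := by
    rw [← Finset.sum_div, Finset.sum_add_distrib, wlen_shift h n P h1 1, wlen]
    ring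
  rw [this, Complex.ofReal_sum, Finset.mul_sum, Complex.exp_sum]
  refine Finset.prod_congr rfl fun i _ => ?_
  rw [edgeMatrix, Matrix.of_apply, if_pos ⟨h2 i, h3 i⟩]

theorem primWord_value {V E : Type} [DecidableEq V] [DecidableEq E] (o t : E → V) (ι : E → E)
    (h : E → ℝ) (s : ℂ) (x : {p : ℕ × (ℕ → E) // IsPrimLoop o t ι p.1 p.2} × ℕ) :
    (∏ i, edgeMatrix o t ι h s ((primWord o t ι x).2 i) ((primWord o t ι x).2 (i+1))) /
        (((primWord o t ι x).1 : ℂ) + 1) =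
      (Complex.exp (-s * (wlen h x.1.1.1 x.1.1.2 : ℂ)) ^ (x.2 + 1) / ((x.2 : ℂ) + 1)) *
        ((x.1.1.1 : ℂ))⁻¹ := by
  have hc : (((primWord o t ι x).1 : ℂ) + 1) = (((cycExt (primWord o t ι x)).1 : ℕ) : ℂ) := by
    simp [cycExt]
  obtain ⟨⟨h0, h1, h2, h3⟩, h4⟩ := x.1.2
  have hloop : IsLoop o t ι (x.1.1.1 * (x.2 + 1)) x.1.1.2 :=
    ⟨Nat.mul_pos h0 (Nat.succ_pos _),
      (isPeriodicPt_iff _ _).1 (((isPeriodicPt_iff _ _).2 h1).mul_const _), h2, h3⟩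
  rw [hc, cycExt_prod, cycExt_primWord]
  simp only
  rw [loop_prod o t ι h s _ _ hloop, wlen_mul h _ _ h1, ← Complex.exp_nat_mul]
  have e : (-s * (((x.2 + 1 : ℕ) * wlen h x.1.1.1 x.1.1.2 : ℝ) : ℂ)) =
    ((x.2 + 1 : ℕ) : ℂ) * (-s * (wlen h x.1.1.1 x.1.1.2 : ℂ)) := by
    push_cast
    ring
  rw [e, div_mul_eq_mul_div, div_eq_mul_inv, div_eq_mul_inv]
  push_cast
  rw [mul_inv]
  ring

theorem wlen_pos {E : Type} (h : E → ℝ) (hpos : ∀ e, 0 < h e) (n : ℕ) (hn : 0 < n) (P : ℕ → E) :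
    0 < wlen h n P :=
  Finset.sum_pos (fun i _ => hpos _) ⟨0, Finset.mem_range.2 hn⟩

theorem words_summable {E : Type} [Fintype E] (W : Matrix E E ℂ) (q : ℝ) (hq0 : 0 ≤ q)
    (hq : ∀ i j, ‖W i j‖ ≤ q) (hq1 : Fintype.card E * q < 1) :
    Summable (fun x : Σ k : ℕ, (Fin (k+1) → E) =>
      (∏ i, W (x.2 i) (x.2 (i+1))) / ((x.1 : ℂ) + 1)) := by
  apply Summable.of_norm
  have hb : ∀ x : Σ k : ℕ, (Fin (k+1) → E),
      ‖(∏ i, W (x.2 i) (x.2 (i+1))) / ((x.1 : ℂ) + 1)‖ ≤ q ^ (x.1 + 1) := by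
    rintro ⟨k, f⟩
    simp only [norm_div, norm_prod]
    have h1 : ‖(k : ℂ) + 1‖ = (k : ℝ) + 1 := by
      have := Complex.norm_natCast (k + 1)
      push_cast at this
      exact this
    have h2 : ∏ i, ‖W (f i) (f (i+1))‖ ≤ q ^ (k+1) := by
      calc ∏ i, ‖W (f i) (f (i+1))‖ ≤ ∏ i : Fin (k+1), q :=
            Finset.prod_le_prod (fun i _ => norm_nonneg _) (fun i _ => hq _ _)
        _ = q ^ (k+1) := by simp
    rw [h1]
    refine (div_le_self (Finset.prod_nonneg fun i _ => norm_nonneg _) ?_).trans h2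
    have : (0 : ℝ) ≤ k := Nat.cast_nonneg k
    linarith
  refine Summable.of_nonneg_of_le (fun _ => norm_nonneg _) hb ?_
  rw [summable_sigma_of_nonneg (fun x => pow_nonneg hq0 _)]
  refine ⟨fun k => (hasSum_fintype _).summable, ?_⟩
  have hg : Summable (fun k : ℕ => ((Fintype.card E : ℝ) * q) ^ (k + 1)) :=
    (summable_nat_add_iff 1).2 (summable_geometric_of_lt_one (by positivity) hq1)
  convert hg using 2 with k
  rw [tsum_fintype]
  simp [mul_pow]

theorem hasProd_loops {V E : Type} [Fintype V] [Fintype E] [DecidableEq V] [DecidableEq E]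
    (o t : E → V) (ι : E → E) (h : E → ℝ) (hpos : ∀ e, 0 < h e) (s : ℂ) (hs : 0 < s.re) (q : ℝ)
    (hq0 : 0 ≤ q) (hq : ∀ i j, ‖edgeMatrix o t ι h s i j‖ ≤ q) (hq1 : Fintype.card E * q < 1) :
    HasProd (fun c : LoopClasses o t ι =>
      1 - Complex.exp (-s * (classWlen o t ι h c : ℂ))) (1 - edgeMatrix o t ι h s).det := by
  obtain ⟨L, hL, hdet⟩ := det_one_sub_eq_exp (edgeMatrix o t ι h s) q hq hq1
  have hsum := words_summable (edgeMatrix o t ι h s) q hq0 hq hq1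
  obtain ⟨T, hT⟩ := hsum
  have hTL : T = L := by
    refine HasSum.unique (hT.sigma fun k => hasSum_fintype _) ?_
    convert hL using 2 with k
    rw [trace_pow_cyc, Finset.sum_div]
  subst hTL
  have hT2 := (primWord_inj (o := o) (t := t) (ι := ι)).hasSum_iff (a := T) (f := fun x : Σ k : ℕ, (Fin (k+1) → E) =>
      (∏ i, edgeMatrix o t ι h s (x.2 i) (x.2 (i+1))) / ((x.1 : ℂ) + 1)) (by
    intro x hx
    by_contra hne
    apply hx
    apply primWord_range o t ι h s x
    intro h0
    rw [h0] at hne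
    simp at hne) |>.2 hT
  have hT3 : HasSum (fun x : {p : ℕ × (ℕ → E) // IsPrimLoop o t ι p.1 p.2} × ℕ =>
      (Complex.exp (-s * (wlen h x.1.1.1 x.1.1.2 : ℂ)) ^ (x.2 + 1) / ((x.2 : ℂ) + 1)) *
        ((x.1.1.1 : ℂ))⁻¹) T := by
    convert hT2 using 1
    funext x
    exact (primWord_value o t ι h s x).symm
  have hlt : ∀ r : ℝ, 0 < r → ‖Complex.exp (-s * (r : ℂ))‖ < 1 := by
    intro r hr
    rw [Complex.norm_exp, Real.exp_lt_one_iff]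
    simp
    positivity
  have hfib : ∀ p : {p : ℕ × (ℕ → E) // IsPrimLoop o t ι p.1 p.2}, HasSum (fun k : ℕ =>
      (Complex.exp (-s * (wlen h p.1.1 p.1.2 : ℂ)) ^ (k + 1) / ((k : ℂ) + 1)) * ((p.1.1 : ℂ))⁻¹)
      (-Complex.log (1 - Complex.exp (-s * (wlen h p.1.1 p.1.2 : ℂ))) * ((p.1.1 : ℂ))⁻¹) := by
    intro p
    have hz := hlt (wlen h p.1.1 p.1.2) (wlen_pos h hpos p.1.1 p.2.1.1 p.1.2)
    generalize Complex.exp (-s * (wlen h p.1.1 p.1.2 : ℂ)) = z at hz ⊢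
    exact (Complex.hasSum_taylorSeries_neg_log' hz).mul_right ((p.1.1 : ℂ))⁻¹
  have hT4 : HasSum (fun p : {p : ℕ × (ℕ → E) // IsPrimLoop o t ι p.1 p.2} =>
      -Complex.log (1 - Complex.exp (-s * (wlen h p.1.1 p.1.2 : ℂ))) * ((p.1.1 : ℂ))⁻¹) T :=
    hT3.prod_fiberwise hfib
  have hT5 := ((Equiv.sigmaFiberEquiv (Quot.mk (LoopRel o t ι))).hasSum_iff.2 hT4).sigma
    (g := fun c : LoopClasses o t ι =>
      -Complex.log (1 - Complex.exp (-s * (classWlen o t ι h c : ℂ)))) (by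
    intro c
    obtain ⟨p, rfl⟩ := Quot.exists_rep c
    obtain ⟨e⟩ := fiber_equiv p
    rw [← e.hasSum_iff]
    have hconst : ∀ i, (((fun y => ((fun p : {p : ℕ × (ℕ → E) // IsPrimLoop o t ι p.1 p.2} =>
      -Complex.log (1 - Complex.exp (-s * (wlen h p.1.1 p.1.2 : ℂ))) * ((p.1.1 : ℂ))⁻¹) ∘
        (Equiv.sigmaFiberEquiv (Quot.mk (LoopRel o t ι)))) ⟨Quot.mk _ p, y⟩) ∘ e) i) =
        -Complex.log (1 - Complex.exp (-s * (wlen h p.1.1 p.1.2 : ℂ))) * ((p.1.1 : ℂ))⁻¹ := by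
      intro i
      have h1 : (e i).1.1.1 = p.1.1 := (loopRel_of_mk_eq (e i).2).1
      have h2 : wlen h (e i).1.1.1 (e i).1.1.2 = wlen h p.1.1 p.1.2 := by
        rw [← classWlen_mk o t ι h, ← classWlen_mk o t ι h, (e i).2]
      show -Complex.log (1 - Complex.exp (-s * (wlen h (e i).1.1.1 (e i).1.1.2 : ℂ))) *
        (((e i).1.1.1 : ℂ))⁻¹ = _
      rw [h2, h1]
    have hf := hasSum_fintype (fun _ : Fin p.1.1 =>
      -Complex.log (1 - Complex.exp (-s * (wlen h p.1.1 p.1.2 : ℂ))) * ((p.1.1 : ℂ))⁻¹)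
    have hn : (p.1.1 : ℂ) ≠ 0 := Nat.cast_ne_zero.2 p.2.1.1.ne'
    have hval : ∑ _i : Fin p.1.1,
      -Complex.log (1 - Complex.exp (-s * (wlen h p.1.1 p.1.2 : ℂ))) * ((p.1.1 : ℂ))⁻¹ =
      -Complex.log (1 - Complex.exp (-s * (classWlen o t ι h (Quot.mk _ p) : ℂ))) := by
      rw [classWlen_mk, Finset.sum_const, Finset.card_univ, Fintype.card_fin, nsmul_eq_mul]
      field_simp
    rw [hval] at hf
    convert hf using 1
    funext i
    exact hconst i)
  have hT6 := hT5.neg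
  simp only [neg_neg] at hT6
  rw [← hdet]
  refine Complex.hasProd_of_hasSum_log ?_ hT6
  intro c h0
  obtain ⟨p, rfl⟩ := Quot.exists_rep c
  rw [classWlen_mk, sub_eq_zero] at h0
  have := hlt _ (wlen_pos h hpos _ p.2.1.1 p.1.2)
  rw [← h0] at this
  simp at this

theorem edgeMatrix_det_differentiable {V E : Type} [Fintype E] [DecidableEq V] [DecidableEq E]
    (o t : E → V) (ι : E → E) (h : E → ℝ) :
    Differentiable ℂ (fun s => (1 - edgeMatrix o t ι h s).det) := by
  simp only [Matrix.det_apply']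
  refine Differentiable.fun_sum fun σ _ => Differentiable.const_mul ?_ _
  refine Differentiable.fun_finsetProd fun i _ => ?_
  simp only [Matrix.sub_apply, edgeMatrix, Matrix.of_apply]
  refine Differentiable.sub (differentiable_const _) ?_
  split_ifs
  · fun_prop
  · fun_prop

/-- **Proposition 5.1** (Ihara, Hashimoto, Bass; weighted version): for `Re s` large the
weighted Ihara zeta function `Z_I(G,h,s) = ∏_{[P]} (1 - e^{-s ℓ_h(P)})` converges and
equals `det(I - W(s))`; in particular it extends to an entire function. -/
theorem weighted_ihara_determinant_formula
    {V E : Type} [Fintype V] [Fintype E] [DecidableEq V] [DecidableEq E] [Nonempty E]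
    (o t : E → V) (ι : E → E)
    (hinv : ∀ e, ι (ι e) = e) (hfpf : ∀ e, ι e ≠ e)
    (hoι : ∀ e, o (ι e) = t e) (htι : ∀ e, t (ι e) = o e)
    (h : E → ℝ) (hpos : ∀ e, 0 < h e) :
    ∃ σ₀ : ℝ,
      (∀ s : ℂ, σ₀ < s.re →
        Multipliable (fun c : LoopClasses o t ι =>
          1 - Complex.exp (-s * (classWlen o t ι h c : ℂ))) ∧
        (∏' c : LoopClasses o t ι, (1 - Complex.exp (-s * (classWlen o t ι h c : ℂ)))) =
          (1 - edgeMatrix o t ι h s).det) ∧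
      ∃ Z : ℂ → ℂ, Differentiable ℂ Z ∧
        ∀ s : ℂ, σ₀ < s.re →
          Z s = ∏' c : LoopClasses o t ι,
            (1 - Complex.exp (-s * (classWlen o t ι h c : ℂ))) := by
  classical
  obtain ⟨e₀, he₀⟩ := Finite.exists_min h
  have hm := hpos e₀
  have hcard : (1 : ℝ) ≤ Fintype.card E := by exact_mod_cast Fintype.card_pos
  have key : ∀ s : ℂ, Real.log (Fintype.card E) / h e₀ < s.re →
      HasProd (fun c : LoopClasses o t ι =>
        1 - Complex.exp (-s * (classWlen o t ι h c : ℂ))) (1 - edgeMatrix o t ι h s).det := by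
    intro s hs
    have hs0 : 0 < s.re := lt_of_le_of_lt (div_nonneg (Real.log_nonneg hcard) hm.le) hs
    refine hasProd_loops o t ι h hpos s hs0 (Real.exp (-(s.re * h e₀))) (Real.exp_pos _).le ?_ ?_
    · intro i j
      rw [edgeMatrix, Matrix.of_apply]
      split_ifs
      · rw [Complex.norm_exp, Real.exp_le_exp, Complex.re_mul_ofReal, Complex.neg_re, neg_mul,
          neg_le_neg_iff]
        refine mul_le_mul_of_nonneg_left ?_ hs0.le
        linarith [he₀ i, he₀ j]
      · rw [norm_zero]
        exact (Real.exp_pos _).le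
    · rw [div_lt_iff₀ hm] at hs
      have hc0 : (0 : ℝ) < Fintype.card E := by linarith
      rw [Real.exp_neg, ← div_eq_mul_inv, div_lt_one (Real.exp_pos _)]
      exact (Real.log_lt_iff_lt_exp hc0).1 hs
  refine ⟨Real.log (Fintype.card E) / h e₀, fun s hs => ⟨(key s hs).multipliable, (key s hs).tprod_eq⟩,
    fun s => (1 - edgeMatrix o t ι h s).det, edgeMatrix_det_differentiable o t ι h,
    fun s hs => (key s hs).tprod_eq.symm⟩

end
end

section
/- Let C ≥ 1. There exists a constant C' > 0 depending only on C with the following property. Let n ≥ 1 and let A : 𝔻* → SL₂(ℂ) be a family with entries holomorphic on 𝔻* and meromorphic at 0, such that A(z) is loxodromic for every z ∈ 𝔻*, and tr(A(z)) = z^{−n}·Σ_{j≥0} A_j z^j (convergent on 𝔻) with |A₀| ≥ C^{−1}e^{−Cn} and |A_j| ≤ C·e^{j+Cn} for all j ≥ 0. Then there are complex numbers a₀, a₁, a₂, … with |a₀| ≤ 2C'n and |a_j| ≤ C'·e^{2C'n(j+1)} for j ≥ 1, such that for all 0 < |z| < e^{−C'n} the series Σ_{j≥0} a_j z^j converges absolutely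 and ℓ(A(z)) = 2n·log(1/|z|) + Re(Σ_{j≥0} a_j z^j), where ℓ(A) := 2·log(spectral radius of A). (This is Proposition 4.1: the expansion ℓ(γ_z) = ℓ^{na}(γ)·log(1/|z|) + Re Σ a_j(γ) z^j with ℓ^{na}(γ) = 2n and exponential bounds on the coefficients.) -/
noncomputable section

/-- The spectral radius of a `2×2` complex matrix: the largest absolute value of an
eigenvalue. -/
def spectralRadC (A : Matrix (Fin 2) (Fin 2) ℂ) : ℝ :=
  sSup {r : ℝ | ∃ μ ∈ spectrum ℂ A, r = ‖μ‖}

/-- The (translation) length `ℓ(A) = 2 log(spectral radius of A)`. -/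
def matLength (A : Matrix (Fin 2) (Fin 2) ℂ) : ℝ := 2 * Real.log (spectralRadC A)

/-- A matrix is loxodromic if its two eigenvalues have distinct absolute values. -/
def IsLoxodromic (A : Matrix (Fin 2) (Fin 2) ℂ) : Prop :=
  ∃ μ ∈ spectrum ℂ A, ∃ ν ∈ spectrum ℂ A, ‖μ‖ ≠ ‖ν‖

lemma spectralRadC_eq (M : Matrix (Fin 2) (Fin 2) ℂ) (l m : ℂ) (hlm : l * m = 1)
    (htr : M.trace = l + m) (hdet : M.det = 1) (hle : ‖m‖ ≤ ‖l‖) :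
    spectralRadC M = ‖l‖ := by
  have key : ∀ μ : ℂ, μ ∈ spectrum ℂ M ↔ (μ - l) * (μ - m) = 0 := by
    intro μ
    rw [Matrix.mem_spectrum_iff_isRoot_charpoly, Matrix.charpoly_fin_two, htr, hdet]
    simp only [Polynomial.IsRoot, Polynomial.eval_add, Polynomial.eval_sub, Polynomial.eval_pow,
      Polynomial.eval_mul, Polynomial.eval_C, Polynomial.eval_X]
    have : μ ^ 2 - (l + m) * μ + 1 = (μ - l) * (μ - m) := by
      rw [← hlm]; ring
    rw [this]
  unfold spectralRadC
  apply IsGreatest.csSup_eq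
  constructor
  · exact ⟨l, by rw [key]; ring, rfl⟩
  · rintro r ⟨μ, hμ, rfl⟩
    rw [key, mul_eq_zero, sub_eq_zero, sub_eq_zero] at hμ
    rcases hμ with rfl | rfl
    · exact le_rfl
    · exact hle

lemma norm_log_le_five (x : ℂ) (h1 : 1 / 2 ≤ ‖x‖) (h2 : ‖x‖ ≤ 2) : ‖Complex.log x‖ ≤ 5 := by
  have hp : 0 < ‖x‖ := by linarith
  have h := Complex.norm_le_abs_re_add_abs_im (Complex.log x)
  rw [Complex.log_re, Complex.log_im] at h
  have h3 := Complex.abs_arg_le_pi x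
  have h4 := Real.pi_lt_four
  have h5 : |Real.log ‖x‖| ≤ 1 := by
    rw [abs_le]
    constructor
    · have := Real.one_sub_inv_le_log_of_pos hp
      have h6 : ‖x‖⁻¹ ≤ 2 := by
        rw [inv_le_comm₀ hp (by norm_num)]; linarith
      linarith
    · have := Real.log_le_sub_one_of_pos hp
      linarith
  linarith

/-- principal square root of `1 - w` -/
def sq1 (w : ℂ) : ℂ := Complex.exp (Complex.log (1 - w) / 2)

lemma one_sub_mem (w : ℂ) (hw : ‖w‖ ≤ 1 / 2) : 1 - w ∈ Complex.slitPlane := by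
  have := Complex.mem_slitPlane_of_norm_lt_one (z := -w) (by rw [norm_neg]; linarith)
  rwa [← sub_eq_add_neg] at this

lemma sq1_sq (w : ℂ) (hw : ‖w‖ ≤ 1 / 2) : sq1 w ^ 2 = 1 - w := by
  unfold sq1
  rw [← Complex.exp_nat_mul]
  have : ((2 : ℕ) : ℂ) * (Complex.log (1 - w) / 2) = Complex.log (1 - w) := by
    push_cast; ring
  rw [this, Complex.exp_log (Complex.slitPlane_ne_zero (one_sub_mem w hw))]

lemma sq1_re (w : ℂ) : 0 ≤ (sq1 w).re := by
  unfold sq1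
  rw [Complex.exp_re]
  apply mul_nonneg (Real.exp_pos _).le
  have him : (Complex.log (1 - w) / 2).im = (1 - w).arg / 2 := by
    rw [← Complex.log_im]
    simp
  rw [him]
  apply Real.cos_nonneg_of_mem_Icc
  have := abs_le.1 (Complex.abs_arg_le_pi (1 - w))
  constructor <;> linarith [this.1, this.2]

lemma half_bounds (w : ℂ) (hw : ‖w‖ ≤ 1 / 2) :
    1 / 2 ≤ ‖(1 + sq1 w) / 2‖ ∧ ‖(1 + sq1 w) / 2‖ ≤ 2 ∧
      (1 + sq1 w) / 2 ∈ Complex.slitPlane ∧ ‖(1 - sq1 w) / 2‖ ≤ ‖(1 + sq1 w) / 2‖ := by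
  have hre := sq1_re w
  have hr : ((1 + sq1 w) / 2).re = (1 + (sq1 w).re) / 2 := by simp
  have hn : ‖sq1 w‖ ≤ 2 := by
    have h1 : ‖sq1 w‖ ^ 2 ≤ 3 / 2 := by
      rw [← norm_pow, sq1_sq w hw]
      have := norm_sub_le (1 : ℂ) w
      rw [norm_one] at this
      linarith
    nlinarith [norm_nonneg (sq1 w)]
  refine ⟨?_, ?_, ?_, ?_⟩
  · have := Complex.re_le_norm ((1 + sq1 w) / 2)
    rw [hr] at this
    linarith
  · rw [norm_div]
    have := norm_add_le (1 : ℂ) (sq1 w)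
    rw [norm_one] at this
    have h2 : ‖(2 : ℂ)‖ = 2 := by simp
    rw [h2]
    linarith
  · left
    rw [hr]; linarith
  · rw [norm_div, norm_div]
    gcongr ?_ / _
    rw [← sq_le_sq₀ (norm_nonneg _) (norm_nonneg _), Complex.sq_norm, Complex.sq_norm,
      Complex.normSq_apply, Complex.normSq_apply]
    simp only [Complex.sub_re, Complex.add_re, Complex.one_re, Complex.sub_im, Complex.add_im,
      Complex.one_im]
    nlinarith

lemma term_bound (Ac : ℕ → ℂ) (B : ℝ) (hB : 1 ≤ B)
    (hA : ∀ j : ℕ, ‖Ac j‖ ≤ B * Real.exp j) (z : ℂ) (e : ℝ) (hz : Real.exp 1 * ‖z‖ ≤ e) (j : ℕ) :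
    ‖Ac j * z ^ j‖ ≤ B * e ^ j := by
  rw [norm_mul, norm_pow]
  calc ‖Ac j‖ * ‖z‖ ^ j ≤ B * Real.exp j * ‖z‖ ^ j := by gcongr; exact hA j
    _ = B * (Real.exp 1 * ‖z‖) ^ j := by
        rw [mul_pow, ← Real.exp_nat_mul, mul_one]; ring
    _ ≤ B * e ^ j := by gcongr

lemma T_diff (Ac : ℕ → ℂ) (B : ℝ) (hB : 1 ≤ B)
    (hA : ∀ j : ℕ, ‖Ac j‖ ≤ B * Real.exp j) (z : ℂ) (hz : Real.exp 1 * ‖z‖ < 1 / 2) :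
    DifferentiableAt ℂ (fun z : ℂ => ∑' j : ℕ, Ac j * z ^ j) z := by
  have hopen : IsOpen {z : ℂ | Real.exp 1 * ‖z‖ < 1 / 2} :=
    isOpen_lt (by fun_prop) continuous_const
  have := Complex.differentiableOn_tsum_of_summable_norm (U := {z : ℂ | Real.exp 1 * ‖z‖ < 1 / 2})
    (F := fun j z => Ac j * z ^ j) (u := fun j => B * (1 / 2) ^ j)
    (summable_geometric_two.mul_left B) (fun i => by fun_prop) hopen
    (fun i w hw => term_bound Ac B hB hA w _ (le_of_lt hw) i)
  exact this.differentiableAt (hopen.mem_nhds hz)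

lemma T_close (Ac : ℕ → ℂ) (B : ℝ) (hB : 1 ≤ B) (e : ℝ) (he : 0 ≤ e) (heB : 8 * B ^ 2 * e ≤ 1)
    (hA : ∀ j : ℕ, ‖Ac j‖ ≤ B * Real.exp j) (hA0 : B⁻¹ ≤ ‖Ac 0‖)
    (z : ℂ) (hz : Real.exp 1 * ‖z‖ ≤ e) :
    ‖(∑' j : ℕ, Ac j * z ^ j) - Ac 0‖ ≤ ‖Ac 0‖ / 2 := by
  have he8 : e ≤ 1 / 2 := by nlinarith
  have hsum : Summable (fun j : ℕ => Ac j * z ^ j) :=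
    Summable.of_norm_bounded (summable_geometric_two.mul_left B)
      (fun j => term_bound Ac B hB hA z _ (hz.trans he8) j)
  rw [hsum.tsum_eq_zero_add]
  simp only [pow_zero, mul_one, add_sub_cancel_left]
  have h1 : ‖∑' j : ℕ, Ac (j + 1) * z ^ (j + 1)‖ ≤ B * e * 2 := by
    apply tsum_of_norm_bounded (hasSum_geometric_two.mul_left (B * e))
    intro j
    refine (term_bound Ac B hB hA z e hz (j + 1)).trans ?_
    have : e ^ j ≤ (1 / 2) ^ j := by gcongr
    calc B * e ^ (j + 1) = B * e * e ^ j := by ring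
      _ ≤ B * e * (1 / 2) ^ j := by gcongr
  have h2 : B * e * 2 ≤ B⁻¹ / 2 := by
    have hp : 0 < B := by linarith
    have : B * e * 2 = (8 * B ^ 2 * e) * B⁻¹ / 4 := by field_simp; ring
    rw [this]
    have hi : 0 < B⁻¹ := by positivity
    nlinarith
  linarith

lemma w_small (B : ℝ) (hB : 1 ≤ B) (e : ℝ) (he : 0 ≤ e) (heB : 8 * B ^ 2 * e ≤ 1)
    (z t : ℂ) (hz : Real.exp 1 * ‖z‖ ≤ e) (n : ℕ) (hn : 1 ≤ n) (ht : B⁻¹ / 2 ≤ ‖t‖) :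
    ‖4 * z ^ (2 * n) / t ^ 2‖ ≤ 1 / 2 := by
  have hp : 0 < B := by linarith
  have hi : 0 < B⁻¹ := by positivity
  have he8 : e ≤ 1 / 8 := by
    nlinarith [mul_nonneg (sub_nonneg.2 (one_le_pow₀ hB (n := 2))) he]
  have hze : ‖z‖ ≤ e := by
    have : 1 ≤ Real.exp 1 := Real.one_le_exp (by norm_num)
    nlinarith [norm_nonneg z]
  have ht0 : 0 < ‖t‖ := by linarith
  rw [norm_div, norm_mul, norm_pow, norm_pow, div_le_iff₀ (by positivity)]
  have h4 : ‖(4 : ℂ)‖ = 4 := by simp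
  rw [h4]
  have h1 : ‖z‖ ^ (2 * n) ≤ e ^ 2 := by
    calc ‖z‖ ^ (2 * n) ≤ ‖z‖ ^ 2 := pow_le_pow_of_le_one (norm_nonneg z) (by linarith) (by omega)
      _ ≤ e ^ 2 := by gcongr
  have h2 : (B⁻¹ / 2) ^ 2 ≤ ‖t‖ ^ 2 := by gcongr
  have h3 : 8 * e ≤ B⁻¹ ^ 2 := by
    have : 8 * e = (8 * B ^ 2 * e) * B⁻¹ ^ 2 := by field_simp
    rw [this]
    nlinarith [sq_nonneg B⁻¹]
  nlinarith

/-- **Proposition 4.1**: the expansion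
`ℓ(A(z)) = 2n·log(1/|z|) + Re(Σ_{j≥0} a_j z^j)` with exponential bounds on the
coefficients `a_j`. -/
theorem length_expansion_of_degenerating_family :
    ∀ C : ℝ, 1 ≤ C → ∃ C' : ℝ, 0 < C' ∧
      ∀ n : ℕ, 1 ≤ n → ∀ A : ℂ → Matrix (Fin 2) (Fin 2) ℂ, ∀ Ac : ℕ → ℂ,
        (∀ z ∈ Metric.ball (0 : ℂ) 1 \ {0}, (A z).det = 1) →
        (∀ i j : Fin 2, ∃ (N : ℕ) (g : ℂ → ℂ),
          DifferentiableOn ℂ g (Metric.ball 0 1) ∧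
          ∀ z ∈ Metric.ball (0 : ℂ) 1 \ {0}, A z i j = g z / z ^ N) →
        (∀ z ∈ Metric.ball (0 : ℂ) 1 \ {0}, IsLoxodromic (A z)) →
        C⁻¹ * Real.exp (-C * n) ≤ ‖Ac 0‖ →
        (∀ j : ℕ, ‖Ac j‖ ≤ C * Real.exp ((j : ℝ) + C * n)) →
        (∀ z ∈ Metric.ball (0 : ℂ) 1, Summable (fun j : ℕ => Ac j * z ^ j)) →
        (∀ z ∈ Metric.ball (0 : ℂ) 1 \ {0},
          (A z).trace = (∑' j : ℕ, Ac j * z ^ j) / z ^ n) →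
        ∃ a : ℕ → ℂ,
          ‖a 0‖ ≤ 2 * C' * n ∧
          (∀ j : ℕ, 1 ≤ j → ‖a j‖ ≤ C' * Real.exp (2 * C' * n * (j + 1))) ∧
          ∀ z : ℂ, 0 < ‖z‖ → ‖z‖ < Real.exp (-C' * n) →
            Summable (fun j : ℕ => ‖a j * z ^ j‖) ∧
            matLength (A z) = 2 * n * Real.log (1 / ‖z‖) + (∑' j : ℕ, a j * z ^ j).re := by
  intro C hC
  refine ⟨40 * C, by linarith, ?_⟩
  intro n hn A Ac hdet _ _ hA0 hAj _ htr
  have hn1 : (1 : ℝ) ≤ n := by exact_mod_cast hn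
  have hCn : C ≤ C * n := by nlinarith
  set B : ℝ := C * Real.exp (C * n) with hBdef
  set r : ℝ := Real.exp (-(40 * C) * n) with hrdef
  have hrpos : 0 < r := Real.exp_pos _
  have hB : 1 ≤ B := by
    have : 1 ≤ Real.exp (C * n) := Real.one_le_exp (by linarith)
    nlinarith
  have hB0 : 0 < B := by linarith
  have hA : ∀ j : ℕ, ‖Ac j‖ ≤ B * Real.exp j := by
    intro j
    refine (hAj j).trans (le_of_eq ?_)
    rw [Real.exp_add, hBdef]; ring
  have hA0' : B⁻¹ ≤ ‖Ac 0‖ := by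
    refine le_trans (le_of_eq ?_) hA0
    rw [hBdef, mul_inv, ← Real.exp_neg]
    congr 2; ring
  have hA0pos : 0 < ‖Ac 0‖ := lt_of_lt_of_le (by positivity) hA0'
  have hA0ne : Ac 0 ≠ 0 := norm_pos_iff.1 hA0pos
  have hBexp : B ≤ Real.exp (2 * C * n) := by
    have h1 : C ≤ Real.exp (C * n) := by
      have := Real.add_one_le_exp (C * n)
      linarith
    calc B ≤ Real.exp (C * n) * Real.exp (C * n) := by rw [hBdef]; gcongr
      _ = _ := by rw [← Real.exp_add]; congr 1; ring
  have heB : 8 * B ^ 2 * (Real.exp 1 * r) ≤ 1 := by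
    have h8 : (8 : ℝ) ≤ Real.exp 7 := by
      have := Real.add_one_le_exp (7 : ℝ)
      linarith
    calc 8 * B ^ 2 * (Real.exp 1 * r)
        ≤ Real.exp 7 * Real.exp (2 * C * n) ^ 2 * (Real.exp 1 * r) := by gcongr
      _ = Real.exp (8 - 36 * (C * n)) := by
          rw [hrdef, ← Real.exp_nat_mul, ← Real.exp_add, ← Real.exp_add, ← Real.exp_add]
          congr 1; push_cast; ring
      _ ≤ 1 := by rw [Real.exp_le_one_iff]; linarith
  have he0 : 0 ≤ Real.exp 1 * r := by positivity
  have he8 : Real.exp 1 * r ≤ 1 / 8 := by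
    nlinarith [mul_nonneg (sub_nonneg.2 (one_le_pow₀ hB (n := 2))) he0]
  set T : ℂ → ℂ := fun z => ∑' j : ℕ, Ac j * z ^ j with hT
  set W : ℂ → ℂ := fun z => 4 * z ^ (2 * n) / T z ^ 2 with hW
  set F : ℂ → ℂ := fun z => 2 * (Complex.log (Ac 0) + Complex.log (T z / Ac 0) +
    Complex.log ((1 + sq1 (W z)) / 2)) with hF
  have hzr : ∀ z ∈ Metric.closedBall (0 : ℂ) r, Real.exp 1 * ‖z‖ ≤ Real.exp 1 * r := by
    intro z hz
    rw [mem_closedBall_zero_iff] at hz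
    gcongr
  have hclose : ∀ z ∈ Metric.closedBall (0 : ℂ) r, ‖T z - Ac 0‖ ≤ ‖Ac 0‖ / 2 := fun z hz =>
    T_close Ac B hB _ he0 heB hA hA0' z (hzr z hz)
  have hTlow : ∀ z ∈ Metric.closedBall (0 : ℂ) r, B⁻¹ / 2 ≤ ‖T z‖ := by
    intro z hz
    have h1 := hclose z hz
    have h2 := norm_sub_norm_le (Ac 0) (T z)
    rw [norm_sub_rev] at h2
    linarith
  have hT0 : ∀ z ∈ Metric.closedBall (0 : ℂ) r, T z ≠ 0 := by
    intro z hz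
    have hi : 0 < B⁻¹ := by positivity
    exact norm_pos_iff.1 (by linarith [hTlow z hz])
  have hWs : ∀ z ∈ Metric.closedBall (0 : ℂ) r, ‖W z‖ ≤ 1 / 2 := fun z hz =>
    w_small B hB _ he0 heB z (T z) (hzr z hz) n hn (hTlow z hz)
  have hu : ∀ z ∈ Metric.closedBall (0 : ℂ) r, ‖T z / Ac 0 - 1‖ ≤ 1 / 2 := by
    intro z hz
    have : T z / Ac 0 - 1 = (T z - Ac 0) / Ac 0 := by field_simp
    rw [this, norm_div, div_le_iff₀ hA0pos]
    linarith [hclose z hz]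
  have husl : ∀ z ∈ Metric.closedBall (0 : ℂ) r, T z / Ac 0 ∈ Complex.slitPlane := by
    intro z hz
    have := Complex.mem_slitPlane_of_norm_lt_one (z := T z / Ac 0 - 1) (by linarith [hu z hz])
    rwa [add_sub_cancel] at this
  have hFd : DifferentiableOn ℂ F (Metric.closedBall 0 r) := by
    intro z hz
    apply DifferentiableAt.differentiableWithinAt
    have hTd : DifferentiableAt ℂ T z := T_diff Ac B hB hA z (by linarith [hzr z hz])
    have hWd : DifferentiableAt ℂ W z := by
      apply DifferentiableAt.div (by fun_prop) (by fun_prop)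
      exact pow_ne_zero _ (hT0 z hz)
    have hsd : DifferentiableAt ℂ (fun z => sq1 (W z)) z := by
      unfold sq1
      apply DifferentiableAt.cexp
      apply DifferentiableAt.div_const
      exact DifferentiableAt.clog (by fun_prop) (one_sub_mem _ (hWs z hz))
    apply DifferentiableAt.const_mul
    apply DifferentiableAt.add
    · apply DifferentiableAt.add (by fun_prop)
      exact DifferentiableAt.clog (by fun_prop) (husl z hz)
    · exact DifferentiableAt.clog (by fun_prop) (half_bounds _ (hWs z hz)).2.2.1
  have hlogA0 : ‖Complex.log (Ac 0)‖ ≤ 2 * C * n + 4 := by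
    have h := Complex.norm_le_abs_re_add_abs_im (Complex.log (Ac 0))
    rw [Complex.log_re, Complex.log_im] at h
    have h3 := Complex.abs_arg_le_pi (Ac 0)
    have h4 := Real.pi_lt_four
    have hlB : Real.log B ≤ 2 * C * n := by
      rw [Real.log_le_iff_le_exp hB0]; exact hBexp
    have h5 : |Real.log ‖Ac 0‖| ≤ 2 * C * n := by
      rw [abs_le]
      constructor
      · have := Real.log_le_log (by positivity) hA0'
        rw [Real.log_inv] at this
        linarith
      · have h6 := hA 0
        simp only [Nat.cast_zero, Real.exp_zero, mul_one] at h6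
        have := Real.log_le_log hA0pos h6
        linarith
    linarith
  have hFb : ∀ z ∈ Metric.closedBall (0 : ℂ) r, ‖F z‖ ≤ 32 * C * n := by
    intro z hz
    have h1 : ‖Complex.log (T z / Ac 0)‖ ≤ 5 := by
      have h := hu z hz
      have h2 := norm_sub_norm_le (T z / Ac 0) 1
      have h3 := norm_sub_norm_le 1 (T z / Ac 0)
      rw [norm_sub_rev] at h3
      rw [norm_one] at h2 h3
      exact norm_log_le_five _ (by linarith) (by linarith)
    have h2 : ‖Complex.log ((1 + sq1 (W z)) / 2)‖ ≤ 5 := by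
      have h := half_bounds _ (hWs z hz)
      exact norm_log_le_five _ h.1 h.2.1
    have h3 := norm_add₃_le (a := Complex.log (Ac 0)) (b := Complex.log (T z / Ac 0))
      (c := Complex.log ((1 + sq1 (W z)) / 2))
    have h4 : ‖(2 : ℂ)‖ = 2 := by simp
    simp only [hF]
    rw [norm_mul, h4]
    linarith
  have hcl : DiffContOnCl ℂ F (Metric.ball 0 r) := hFd.diffContOnCl_ball subset_rfl
  have hcoef : ∀ j : ℕ, ‖((j.factorial : ℂ))⁻¹ * iteratedDeriv j F 0‖ ≤ 32 * C * n / r ^ j := by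
    intro j
    have h := Complex.norm_iteratedDeriv_le_of_forall_mem_sphere_norm_le j hrpos hcl
      (fun z hz => hFb z (Metric.sphere_subset_closedBall hz))
    rw [norm_mul, norm_inv, Complex.norm_natCast]
    have hf : (0 : ℝ) < j.factorial := by exact_mod_cast j.factorial_pos
    rw [inv_mul_le_iff₀ hf]
    refine h.trans (le_of_eq (by ring))
  refine ⟨fun j => ((j.factorial : ℂ))⁻¹ * iteratedDeriv j F 0, ?_, ?_, ?_⟩
  · refine (hcoef 0).trans ?_
    rw [pow_zero, div_one]
    nlinarith
  · intro j hj
    refine (hcoef j).trans ?_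
    have hrj : (r ^ j)⁻¹ = Real.exp (40 * C * n * j) := by
      rw [hrdef, ← Real.exp_nat_mul, ← Real.exp_neg]
      congr 1; ring
    rw [div_eq_mul_inv, hrj]
    have hj0 : (0 : ℝ) ≤ j := Nat.cast_nonneg j
    have h1 : (n : ℝ) ≤ Real.exp (n : ℝ) := by linarith [Real.add_one_le_exp (n : ℝ)]
    calc 32 * C * n * Real.exp (40 * C * n * j)
        ≤ 40 * C * Real.exp n * Real.exp (40 * C * n * j) := by gcongr; norm_num
      _ = 40 * C * Real.exp (n + 40 * C * n * j) := by rw [Real.exp_add]; ring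
      _ ≤ 40 * C * Real.exp (2 * (40 * C) * n * (j + 1)) := by
          gcongr 40 * C * Real.exp ?_
          have h2 : (n : ℝ) ≤ C * n := by nlinarith
          have h3 : 0 ≤ C * n * j := by positivity
          nlinarith
  · intro z hz0 hzlt
    have hzb : z ∈ Metric.ball (0 : ℂ) r := by rwa [mem_ball_zero_iff]
    have hzc : z ∈ Metric.closedBall (0 : ℂ) r := Metric.ball_subset_closedBall hzb
    have hz : z ≠ 0 := norm_pos_iff.1 hz0
    have hsum : HasSum (fun j : ℕ => ((j.factorial : ℂ))⁻¹ * iteratedDeriv j F 0 * z ^ j) (F z) := by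
      have := Complex.hasSum_taylorSeries_on_ball (hFd.mono Metric.ball_subset_closedBall) hzb
      simp only [sub_zero, smul_eq_mul] at this
      have heq : (fun j : ℕ => ((j.factorial : ℂ))⁻¹ * iteratedDeriv j F 0 * z ^ j) =
          fun j : ℕ => ((j.factorial : ℂ))⁻¹ * (z ^ j * iteratedDeriv j F 0) := by
        funext j; ring
      rw [heq]; exact this
    refine ⟨hsum.summable.norm, ?_⟩
    rw [hsum.tsum_eq]
    have hr1 : r ≤ 1 := by
      have : 1 ≤ Real.exp 1 := Real.one_le_exp (by norm_num)
      nlinarith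
    have hzD : z ∈ Metric.ball (0 : ℂ) 1 \ {0} :=
      ⟨by rw [mem_ball_zero_iff]; exact lt_of_lt_of_le hzlt hr1, hz⟩
    have hhb := half_bounds _ (hWs z hzc)
    have hTz := hT0 z hzc
    have hsq := sq1_sq _ (hWs z hzc)
    have hspec : spectralRadC (A z) = ‖T z / z ^ n * ((1 + sq1 (W z)) / 2)‖ := by
      apply spectralRadC_eq (A z) _ (T z / z ^ n * ((1 - sq1 (W z)) / 2))
      · have : T z / z ^ n * ((1 + sq1 (W z)) / 2) * (T z / z ^ n * ((1 - sq1 (W z)) / 2))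
          = T z ^ 2 / z ^ (2 * n) * (1 - sq1 (W z) ^ 2) / 4 := by
          rw [pow_mul' z 2 n]
          field_simp
          ring
        rw [this, hsq, hW]
        field_simp
        ring
      · rw [htr z hzD]; ring
      · exact hdet z hzD
      · rw [norm_mul, norm_mul]
        gcongr ?_ * ?_
        exact hhb.2.2.2
    unfold matLength
    rw [hspec]
    have hn1 : ‖T z‖ ≠ 0 := norm_ne_zero_iff.2 hTz
    have hn2 : ‖(1 + sq1 (W z)) / 2‖ ≠ 0 := by linarith [hhb.1]
    have hFre : (F z).re = 2 * (Real.log ‖Ac 0‖ + Real.log ‖T z / Ac 0‖ +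
        Real.log ‖(1 + sq1 (W z)) / 2‖) := by
      simp only [hF]
      rw [← Complex.log_re, ← Complex.log_re, ← Complex.log_re]
      simp
    rw [hFre, norm_mul, norm_div, norm_pow, norm_div (T z), Real.log_mul (by positivity) hn2,
      Real.log_div hn1 (by positivity), Real.log_div hn1 hA0pos.ne', Real.log_pow, one_div,
      Real.log_inv]
    ring

end
end
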